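/- arXiv:2409.00915 — 3 statements merged into one kernel-verified Lean document; each statement's English description precedes it below -/
import Mathlib

section
/- Under the block eigenvalue setup, for all sufficiently large d the following hold: μ_{p+2}(d)^{s/2} ≤ κ*(d) < μ_p(d)^{s/2}; consequently ℓ_j(d) = 0 for every j ≥ v_{p+1}(d) + 1, and N(d) equals v_q(d) for some q ∈ {p, p+1}. -/
open Filter

/-- `N(d,k)`, the dimension of the space of degree-`k` spherical harmonics on `S^d`:
`N(d,0) = 1` and, for `k ≥ 1`,
`N(d,k) = ((2k + d − 1)/k) · (k + d − 2)! / ((d − 1)! (k − 1)!)`. -/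
noncomputable def sphDim (d k : ℕ) : ℝ :=
  if k = 0 then 1
  else ((2 * k + d - 1 : ℝ) / k) * (Nat.factorial (k + d - 2)) /
    (Nat.factorial (d - 1) * Nat.factorial (k - 1))

/-- `v_k(d) := Σ_{k'=0}^{k} N(d,k')`. -/
noncomputable def vdim (d k : ℕ) : ℝ :=
  ∑ k' ∈ Finset.range (k + 1), sphDim d k'

/-- `v_{k-1}(d)`, with the convention `v_{−1}(d) = 0`. -/
noncomputable def vprev (d k : ℕ) : ℝ :=
  ∑ k' ∈ Finset.range k, sphDim d k'

/-- The left-hand side `(σ²/(nκ)) · Σ_{j=1}^{∞} λ_j^{-s/2}(1 − κλ_j^{-s/2})_+` of the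
Pinsker equation (the sum over `j ≥ 1` is written as a sum over `j + 1`, `j : ℕ`). -/
noncomputable def pinskerLHS (s σ : ℝ) (n : ℕ) (lam : ℕ → ℝ) (κ : ℝ) : ℝ :=
  σ ^ 2 / (n * κ) *
    ∑' j : ℕ, lam (j + 1) ^ (-(s / 2)) * max (1 - κ * lam (j + 1) ^ (-(s / 2))) 0

/-- The Pinsker weights `ℓ_j := (1 − κ* λ_j^{-s/2})_+`. -/
noncomputable def pinskerEll (s : ℝ) (lam : ℕ → ℝ) (κstar : ℝ) (j : ℕ) : ℝ :=
  max (1 - κstar * lam j ^ (-(s / 2))) 0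

/-- `N := max { j ≥ 1 : λ_j^{s/2} > κ* }`. -/
noncomputable def blockN (s : ℝ) (lam : ℕ → ℝ) (κstar : ℝ) : ℕ :=
  sSup {j : ℕ | 1 ≤ j ∧ κstar < lam j ^ (s / 2)}

/-- `D* := (σ²/n) Σ_{j=1}^{N} ℓ_j`. -/
noncomputable def pinskerD (s σ : ℝ) (n : ℕ) (lam : ℕ → ℝ) (κstar : ℝ) : ℝ :=
  σ ^ 2 / n * ∑ j ∈ Finset.Icc 1 (blockN s lam κstar), pinskerEll s lam κstar j

/-- The dimension `N(d,k)` as a natural number, a sum of two binomial coefficients. -/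
def sphDimNat (d k : ℕ) : ℕ :=
  if k = 0 then 1 else (k + d - 1).choose k + (k + d - 2).choose (k - 1)

theorem sphDim_eq_natCast {d : ℕ} (hd : 1 ≤ d) (k : ℕ) : sphDim d k = sphDimNat d k := by
  unfold sphDim sphDimNat
  rcases k with _ | k
  · simp
  obtain ⟨e, rfl⟩ : ∃ e, d = e + 1 := ⟨d - 1, by omega⟩
  have h1 : k + 1 + (e + 1) - 1 = (k + 1) + e := by omega
  have h2 : k + 1 + (e + 1) - 2 = k + e := by omega
  simp only [Nat.succ_ne_zero, if_false, h1, h2, Nat.add_sub_cancel]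
  push_cast
  rw [Nat.cast_add_choose, Nat.cast_add_choose]
  have h3 : k + 1 + e = (k + e) + 1 := by ring
  rw [h3, Nat.factorial_succ, Nat.factorial_succ k]
  have hk : (0 : ℝ) < k.factorial := by exact_mod_cast Nat.factorial_pos k
  have he : (0 : ℝ) < e.factorial := by exact_mod_cast Nat.factorial_pos e
  push_cast
  field_simp
  ring

theorem sphDimNat_pos {d : ℕ} (hd : 1 ≤ d) (k : ℕ) : 0 < sphDimNat d k := by
  unfold sphDimNat
  split_ifs with h
  · exact Nat.one_pos
  · exact Nat.add_pos_left (Nat.choose_pos (by omega)) _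

theorem pow_le_factorial_mul_sphDimNat {d : ℕ} (hd : 1 ≤ d) (k : ℕ) :
    d ^ k ≤ k.factorial * sphDimNat d k := by
  unfold sphDimNat
  split_ifs with h
  · simp [h]
  · obtain ⟨e, rfl⟩ : ∃ e, d = e + 1 := ⟨d - 1, by omega⟩
    have h1 : k + (e + 1) - 1 = e + k := by omega
    calc (e + 1) ^ k ≤ (e + 1).ascFactorial k := Nat.pow_succ_le_ascFactorial _ _
      _ = k.factorial * (e + k).choose k := Nat.ascFactorial_eq_factorial_mul_choose e k
      _ ≤ _ := by rw [h1]; exact Nat.mul_le_mul_left _ (Nat.le_add_right _ _)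

theorem sphDimNat_le {d k : ℕ} (hd : 1 ≤ d) (hk : k ≤ d) :
    sphDimNat d k ≤ 2 * (2 * d) ^ k := by
  unfold sphDimNat
  split_ifs with h
  · simp [h]
  · obtain ⟨e, rfl⟩ : ∃ e, d = e + 1 := ⟨d - 1, by omega⟩
    obtain ⟨l, rfl⟩ : ∃ l, k = l + 1 := ⟨k - 1, by omega⟩
    have h1 : l + 1 + (e + 1) - 1 = l + e + 1 := by omega
    have h2 : l + 1 + (e + 1) - 2 = l + e := by omega
    rw [h1, h2, Nat.add_sub_cancel]
    have h3 : (l + e).choose l ≤ (l + e + 1).choose (l + 1) := by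
      rw [Nat.choose_succ_succ]; exact Nat.le_add_right _ _
    have h4 : (l + e + 1).choose (l + 1) ≤ (2 * (e + 1)) ^ (l + 1) :=
      (Nat.choose_le_pow _ _).trans (Nat.pow_le_pow_left (by omega) _)
    omega

/-- The partial sums `v_{k-1}(d)` as natural numbers. -/
def vprevNat (d k : ℕ) : ℕ := ∑ i ∈ Finset.range k, sphDimNat d i

theorem vprev_eq_natCast {d : ℕ} (hd : 1 ≤ d) (k : ℕ) : vprev d k = vprevNat d k := by
  simp [vprev, vprevNat, sphDim_eq_natCast hd]

theorem vdim_eq_natCast {d : ℕ} (hd : 1 ≤ d) (k : ℕ) : vdim d k = vprevNat d (k + 1) :=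
  vprev_eq_natCast hd (k + 1)

theorem vprevNat_succ (d k : ℕ) : vprevNat d (k + 1) = vprevNat d k + sphDimNat d k :=
  Finset.sum_range_succ _ _

theorem tendsto_vprevNat_div_pow (p : ℕ) :
    Tendsto (fun d : ℕ => (vprevNat d p : ℝ) / (d : ℝ) ^ p) atTop (nhds 0) := by
  have key : ∀ k ∈ Finset.range p,
      Tendsto (fun d : ℕ => (sphDimNat d k : ℝ) / (d : ℝ) ^ p) atTop (nhds 0) := by
    intro k hk
    have hkp : k < p := Finset.mem_range.mp hk
    have hlim : Tendsto (fun d : ℕ => ((2 : ℝ) * 2 ^ k) / (d : ℝ)) atTop (nhds 0) :=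
      tendsto_const_div_atTop_nhds_zero_nat _
    refine squeeze_zero' (Eventually.of_forall fun d => by positivity) ?_ hlim
    filter_upwards [eventually_ge_atTop 1, eventually_ge_atTop k] with d hd hdk
    have hd' : (1 : ℝ) ≤ d := by exact_mod_cast hd
    have h1 : (sphDimNat d k : ℝ) ≤ 2 * (2 * d) ^ k := by exact_mod_cast sphDimNat_le hd hdk
    rw [div_le_div_iff₀ (by positivity) (by positivity)]
    have h2 : (d : ℝ) ^ (k + 1) ≤ (d : ℝ) ^ p := pow_le_pow_right₀ hd' hkp
    calc (sphDimNat d k : ℝ) * d ≤ 2 * (2 * d) ^ k * d := by gcongr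
      _ = 2 * 2 ^ k * (d : ℝ) ^ (k + 1) := by ring
      _ ≤ _ := by gcongr
  have := tendsto_finsetSum (Finset.range p) key
  simpa [vprevNat, Finset.sum_div] using this

/-- If `x ^ b` does not exceed `κ`, its Pinsker term vanishes. -/
theorem max_one_sub_mul_rpow_neg_eq_zero {x κ b : ℝ} (hx : 0 < x) (h : x ^ b ≤ κ) :
    max (1 - κ * x ^ (-b)) 0 = 0 := by
  have hxb : 0 < x ^ b := Real.rpow_pos_of_pos hx b
  rw [max_eq_right_iff, Real.rpow_neg hx.le, ← div_eq_mul_inv, sub_nonpos, one_le_div hxb]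
  exact h

theorem pinskerLHS_le {s σ κ : ℝ} {n V : ℕ} {lam : ℕ → ℝ} (hs : 0 < s) (hκ : 0 < κ)
    (hpos : ∀ j, 1 ≤ j → 0 < lam j) (hanti : ∀ i j, 1 ≤ i → i ≤ j → lam j ≤ lam i)
    (hV : lam (V + 1) ^ (s / 2) ≤ κ) :
    pinskerLHS s σ n lam κ ≤ σ ^ 2 * V / (n * κ ^ 2) := by
  unfold pinskerLHS
  have hzero : ∀ j ∉ Finset.range V,
      lam (j + 1) ^ (-(s / 2)) * max (1 - κ * lam (j + 1) ^ (-(s / 2))) 0 = 0 := by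
    intro j hj
    have hj' : V ≤ j := by simpa using hj
    have hp := hpos (j + 1) (by omega)
    rw [max_one_sub_mul_rpow_neg_eq_zero hp, mul_zero]
    exact (Real.rpow_le_rpow hp.le (hanti _ _ (by omega) (by omega)) (by positivity)).trans hV
  have hle : ∀ j, lam (j + 1) ^ (-(s / 2)) * max (1 - κ * lam (j + 1) ^ (-(s / 2))) 0 ≤ κ⁻¹ := by
    intro j
    have hp := Real.rpow_pos_of_pos (hpos (j + 1) (by omega)) (-(s / 2))
    set y := lam (j + 1) ^ (-(s / 2))
    rcases le_total (1 - κ * y) 0 with h | h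
    · rw [max_eq_right h, mul_zero]; positivity
    · rw [max_eq_left h, inv_eq_one_div, le_div_iff₀ hκ]
      nlinarith [mul_pos hκ hp]
  rw [tsum_eq_sum hzero]
  calc _ ≤ σ ^ 2 / (n * κ) * (V * κ⁻¹) := by
        gcongr
        simpa using Finset.sum_le_card_nsmul (Finset.range V) _ _ fun j _ => hle j
    _ = _ := by field_simp

theorem le_pinskerLHS {s σ κ m : ℝ} {n A N : ℕ} {lam : ℕ → ℝ} (hs : 0 < s) (hκ : 0 < κ)
    (hn : 0 < n) (hm : 0 < m) (hpos : ∀ j, 1 ≤ j → 0 < lam j)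
    (hlim : Tendsto lam atTop (nhds 0))
    (hblock : ∀ j, A < j → j ≤ A + N → lam j = m) (hκm : 2 * κ ≤ m ^ (s / 2)) :
    σ ^ 2 * N / (n * m ^ s) ≤ pinskerLHS s σ n lam κ := by
  unfold pinskerLHS
  have hnonneg : ∀ j,
      0 ≤ lam (j + 1) ^ (-(s / 2)) * max (1 - κ * lam (j + 1) ^ (-(s / 2))) 0 := fun j =>
    mul_nonneg (Real.rpow_nonneg (hpos _ (by omega)).le _) (le_max_right _ _)
  have hsum : Summable fun j =>
      lam (j + 1) ^ (-(s / 2)) * max (1 - κ * lam (j + 1) ^ (-(s / 2))) 0 := by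
    have h0 : Tendsto (fun j => lam j ^ (s / 2)) atTop (nhds 0) := by
      simpa [Real.zero_rpow (by positivity : s / 2 ≠ 0)] using
        hlim.rpow_const (p := s / 2) (Or.inr (by positivity))
    obtain ⟨J, hJ⟩ := eventually_atTop.mp (h0.eventually_le_const hκ)
    refine summable_of_ne_finset_zero (s := Finset.range J) fun j hj => ?_
    have hj' : J ≤ j := by simpa using hj
    rw [max_one_sub_mul_rpow_neg_eq_zero (hpos _ (by omega)) (hJ _ (by omega)), mul_zero]
  set y := m ^ (s / 2) with hy
  have hyp : 0 < y := Real.rpow_pos_of_pos hm _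
  have hys : m ^ s = y ^ 2 := by
    rw [hy, ← Real.rpow_natCast, ← Real.rpow_mul hm.le]; congr 1; push_cast; ring
  have hterm : ∀ j ∈ Finset.Ico A (A + N),
      (2 * y)⁻¹ ≤ lam (j + 1) ^ (-(s / 2)) * max (1 - κ * lam (j + 1) ^ (-(s / 2))) 0 := by
    intro j hj
    rw [Finset.mem_Ico] at hj
    rw [hblock (j + 1) (by omega) (by omega), Real.rpow_neg hm.le, ← hy, mul_inv_rev]
    gcongr
    refine le_max_of_le_left ?_
    have : κ * y⁻¹ ≤ 2⁻¹ := by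
      rw [← div_eq_mul_inv, div_le_iff₀ hyp]; linarith
    linarith
  have hS : N * (2 * y)⁻¹ ≤
      ∑' j, lam (j + 1) ^ (-(s / 2)) * max (1 - κ * lam (j + 1) ^ (-(s / 2))) 0 := by
    refine le_trans ?_ (hsum.sum_le_tsum (Finset.Ico A (A + N)) fun j _ => hnonneg j)
    simpa using Finset.card_nsmul_le_sum _ _ _ hterm
  have hn' : (0 : ℝ) < n := by exact_mod_cast hn
  rw [hys]
  calc σ ^ 2 * N / (n * y ^ 2) = σ ^ 2 / (n * (y / 2)) * (N * (2 * y)⁻¹) := by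
        field_simp
    _ ≤ σ ^ 2 / (n * κ) * (N * (2 * y)⁻¹) := by
        gcongr
        linarith
    _ ≤ _ := by gcongr

theorem blockN_eq {s κ : ℝ} {V : ℕ} {lam : ℕ → ℝ} (hs : 0 < s) (hV : 1 ≤ V)
    (hpos : ∀ j, 1 ≤ j → 0 < lam j) (hanti : ∀ i j, 1 ≤ i → i ≤ j → lam j ≤ lam i)
    (h1 : κ < lam V ^ (s / 2)) (h2 : lam (V + 1) ^ (s / 2) ≤ κ) : blockN s lam κ = V := by
  refine IsGreatest.csSup_eq ⟨⟨hV, h1⟩, fun j ⟨hj, hjκ⟩ => ?_⟩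
  by_contra! hlt
  exact absurd (hjκ.trans_le ((Real.rpow_le_rpow (hpos j hj).le
    (hanti _ _ (by omega) (by omega)) (by positivity)).trans h2)) (lt_irrefl _)

/-- Normalization of `n μ^s` by its order of growth `d^{γ - ks}`. -/
theorem mul_rpow_eq_normalized {s γ m n d : ℝ} (hd : 0 < d) (hm : 0 < m) (k : ℕ) :
    n * m ^ s = n / d ^ γ * (d ^ k * m) ^ s * d ^ (γ - k * s) := by
  rw [Real.mul_rpow (by positivity) hm.le, ← Real.rpow_natCast d k, ← Real.rpow_mul hd.le,
    Real.rpow_sub hd]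
  have h1 := Real.rpow_pos_of_pos hd γ
  have h2 := Real.rpow_pos_of_pos hd (k * s)
  field_simp

theorem tendsto_normalized {s α γ A : ℝ} {n : ℕ → ℕ} {m : ℕ → ℝ} {k : ℕ} (hA : 0 < A)
    (hn : Tendsto (fun d : ℕ => (n d : ℝ) / (d : ℝ) ^ γ) atTop (nhds α))
    (hm : Tendsto (fun d : ℕ => (d : ℝ) ^ k * m d) atTop (nhds A)) :
    Tendsto (fun d : ℕ => (n d : ℝ) / (d : ℝ) ^ γ * ((d : ℝ) ^ k * m d) ^ s) atTop
      (nhds (α * A ^ s)) :=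
  hn.mul (hm.rpow_const (Or.inl hA.ne'))

theorem tendsto_vprevNat_div {s α γ A : ℝ} {n : ℕ → ℕ} {m : ℕ → ℝ} {p : ℕ} (hα : 0 < α)
    (hA : 0 < A) (hp : p * (s + 1) ≤ γ) (hmpos : ∀ᶠ d in atTop, 0 < m d)
    (hn : Tendsto (fun d : ℕ => (n d : ℝ) / (d : ℝ) ^ γ) atTop (nhds α))
    (hm : Tendsto (fun d : ℕ => (d : ℝ) ^ p * m d) atTop (nhds A)) :
    Tendsto (fun d : ℕ => (vprevNat d p : ℝ) / (n d * m d ^ s)) atTop (nhds 0) := by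
  have hG := tendsto_normalized (s := s) hA hn hm
  have hlim : 0 < α * A ^ s := by positivity
  have h0 := (tendsto_vprevNat_div_pow p).div hG hlim.ne'
  rw [zero_div] at h0
  refine squeeze_zero' ?_ ?_ h0
  · filter_upwards [hmpos] with d hd
    positivity
  · filter_upwards [hmpos, eventually_ge_atTop 1, hG.eventually_const_lt hlim] with d hd hd1 hGd
    have hd' : (1 : ℝ) ≤ d := by exact_mod_cast hd1
    have hd0 : (0 : ℝ) < d := by linarith
    rw [mul_rpow_eq_normalized (γ := γ) hd0 hd p, Pi.div_apply, div_div]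
    have hpow : (d : ℝ) ^ p ≤ (d : ℝ) ^ (γ - p * s) := by
      rw [← Real.rpow_natCast]
      exact Real.rpow_le_rpow_of_exponent_le hd' (by linarith)
    rw [mul_comm ((d : ℝ) ^ p) (_ / _ * _)]
    exact div_le_div_of_nonneg_left (by positivity) (mul_pos hGd (by positivity))
      (mul_le_mul_of_nonneg_left hpow hGd.le)

theorem tendsto_sphDimNat_div {s α γ A : ℝ} {n : ℕ → ℕ} {m : ℕ → ℝ} {k : ℕ} (hα : 0 < α)
    (hA : 0 < A) (hk : γ < k * (s + 1)) (hmpos : ∀ᶠ d in atTop, 0 < m d)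
    (hn : Tendsto (fun d : ℕ => (n d : ℝ) / (d : ℝ) ^ γ) atTop (nhds α))
    (hm : Tendsto (fun d : ℕ => (d : ℝ) ^ k * m d) atTop (nhds A)) :
    Tendsto (fun d : ℕ => (sphDimNat d k : ℝ) / (n d * m d ^ s)) atTop atTop := by
  have hG := tendsto_normalized (s := s) hA hn hm
  have hlim : 0 < α * A ^ s := by positivity
  have hfac : (0 : ℝ) < k.factorial := by exact_mod_cast Nat.factorial_pos k
  have hpow : Tendsto (fun d : ℕ => (d : ℝ) ^ (k * (s + 1) - γ)) atTop atTop :=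
    (tendsto_rpow_atTop (by linarith)).comp tendsto_natCast_atTop_atTop
  refine tendsto_atTop_mono' _ ?_
    (hpow.const_mul_atTop (by positivity : 0 < (k.factorial * (2 * (α * A ^ s)))⁻¹))
  filter_upwards [hmpos, eventually_ge_atTop 1, hG.eventually_const_lt hlim,
    hG.eventually_lt_const (by linarith : α * A ^ s < 2 * (α * A ^ s))] with d hd hd1 hG0 hG2
  have hd0 : (0 : ℝ) < d := by exact_mod_cast hd1
  have h1 : (d : ℝ) ^ k ≤ k.factorial * sphDimNat d k := by
    exact_mod_cast pow_le_factorial_mul_sphDimNat hd1 k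
  have hx : (0 : ℝ) < (d : ℝ) ^ (γ - k * s) := Real.rpow_pos_of_pos hd0 _
  have h2 : (d : ℝ) ^ (k * (s + 1) - γ) = (d : ℝ) ^ k / (d : ℝ) ^ (γ - k * s) := by
    rw [← Real.rpow_natCast, ← Real.rpow_sub hd0]; congr 1; ring
  rw [mul_rpow_eq_normalized (γ := γ) hd0 hd k, h2]
  set G := (n d : ℝ) / (d : ℝ) ^ γ * ((d : ℝ) ^ k * m d) ^ s
  calc (k.factorial * (2 * (α * A ^ s)))⁻¹ * ((d : ℝ) ^ k / (d : ℝ) ^ (γ - k * s))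
      ≤ (k.factorial * (2 * (α * A ^ s)))⁻¹ *
        (k.factorial * sphDimNat d k / (d : ℝ) ^ (γ - k * s)) := by gcongr
    _ = sphDimNat d k / (2 * (α * A ^ s) * (d : ℝ) ^ (γ - k * s)) := by
        field_simp
    _ ≤ _ := by gcongr

/-- Consecutive block eigenvalues are of different orders in `d`. -/
theorem eventually_two_mul_rpow_le {b A B : ℝ} {x y : ℕ → ℝ} {k : ℕ} (hb : 0 < b)
    (hA : 0 < A) (hxpos : ∀ᶠ d in atTop, 0 < x d) (hypos : ∀ᶠ d in atTop, 0 < y d)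
    (hx : Tendsto (fun d : ℕ => (d : ℝ) ^ k * x d) atTop (nhds A))
    (hy : Tendsto (fun d : ℕ => (d : ℝ) ^ (k + 1) * y d) atTop (nhds B)) :
    ∀ᶠ d in atTop, 2 * y d ^ b ≤ x d ^ b := by
  have hinv : Tendsto (fun d : ℕ => ((d : ℝ))⁻¹) atTop (nhds 0) :=
    tendsto_inv_atTop_zero.comp tendsto_natCast_atTop_atTop
  have h := ((hy.div hx hA.ne').mul hinv).rpow_const (p := b) (Or.inr hb.le)
  rw [mul_zero, Real.zero_rpow hb.ne'] at h
  filter_upwards [hxpos, hypos, eventually_ge_atTop 1,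
    h.eventually_le_const (by norm_num : (0 : ℝ) < 1 / 2)] with d hxd hyd hd1 hd
  have hd0 : (0 : ℝ) < d := by exact_mod_cast hd1
  have heq : ((d : ℝ) ^ (k + 1) * y d) / ((d : ℝ) ^ k * x d) * (d : ℝ)⁻¹ = y d / x d := by
    rw [pow_succ]
    field_simp
  rw [Pi.div_apply, heq, Real.div_rpow hyd.le hxd.le,
    div_le_iff₀ (Real.rpow_pos_of_pos hxd b)] at hd
  linarith

/-- For all sufficiently large `d`: `μ_{p+2}(d)^{s/2} ≤ κ*(d) < μ_p(d)^{s/2}`; consequently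
`ℓ_j(d) = 0` for every `j ≥ v_{p+1}(d) + 1`, and `N(d) = v_q(d)` for some `q ∈ {p, p+1}`. -/
theorem statement8
    (s R σ α γ : ℝ) (hs : 0 < s) (hR : 0 < R) (hσ : 0 < σ) (hα : 0 < α) (hγ : 0 < γ)
    (p : ℕ) (hp : p = ⌊γ / (s + 1)⌋₊)
    (a : ℕ → ℝ) (ha : ∀ k ≤ p + 3, 0 < a k)
    (n : ℕ → ℕ) (hn : ∀ d, 0 < n d)
    (hnlim : Tendsto (fun d : ℕ => (n d : ℝ) / (d : ℝ) ^ γ) atTop (nhds α))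
    (μ : ℕ → ℕ → ℝ)
    (hμlim : ∀ k ≤ p + 3, Tendsto (fun d : ℕ => (d : ℝ) ^ k * μ d k) atTop
      (nhds (a k * Nat.factorial k)))
    (hμorder : ∀ᶠ d in atTop, (∀ k < p + 2, μ d (k + 1) < μ d k) ∧ 0 < μ d (p + 2))
    (lam : ℕ → ℕ → ℝ)
    (hlampos : ∀ d j, 1 ≤ j → 0 < lam d j)
    (hlamanti : ∀ d i j, 1 ≤ i → i ≤ j → lam d j ≤ lam d i)
    (hlamlim : ∀ d, Tendsto (lam d) atTop (nhds 0))
    (hblock : ∀ᶠ d in atTop, ∀ k ≤ p + 2, ∀ j : ℕ,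
      vprev d k < (j : ℝ) → (j : ℝ) ≤ vdim d k → lam d j = μ d k)
    (κstar : ℕ → ℝ)
    (hκ : ∀ d, 0 < κstar d ∧ pinskerLHS s σ (n d) (lam d) (κstar d) = R)
    :
    ∀ᶠ d in atTop,
      μ d (p + 2) ^ (s / 2) ≤ κstar d ∧ κstar d < μ d p ^ (s / 2) ∧
      (∀ j : ℕ, vdim d (p + 1) + 1 ≤ (j : ℝ) → pinskerEll s (lam d) (κstar d) j = 0) ∧
      ((blockN s (lam d) (κstar d) : ℝ) = vdim d p ∨
        (blockN s (lam d) (κstar d) : ℝ) = vdim d (p + 1)) := by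
  have hpγ : (p : ℝ) * (s + 1) ≤ γ := by
    rw [← le_div_iff₀ (by positivity), hp]
    exact Nat.floor_le (by positivity)
  have hγp : γ < ((p + 1 : ℕ) : ℝ) * (s + 1) := by
    rw [← div_lt_iff₀ (by positivity), hp]
    exact_mod_cast Nat.lt_floor_add_one (γ / (s + 1))
  have hA : ∀ k ≤ p + 3, 0 < a k * (Nat.factorial k : ℝ) := fun k hk =>
    mul_pos (ha k hk) (by exact_mod_cast Nat.factorial_pos k)
  have hμpos : ∀ k ≤ p + 3, ∀ᶠ d in atTop, 0 < μ d k := by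
    intro k hk
    filter_upwards [(hμlim k hk).eventually_const_lt (hA k hk)] with d hd
    exact pos_of_mul_pos_right hd (by positivity)
  have hsmall := (tendsto_vprevNat_div (s := s) hα (hA p (by omega)) hpγ
    (hμpos p (by omega)) hnlim (hμlim p (by omega))).const_mul (σ ^ 2)
  rw [mul_zero] at hsmall
  have hlarge := (tendsto_sphDimNat_div (s := s) hα (hA (p + 1) (by omega)) hγp
    (hμpos (p + 1) (by omega)) hnlim (hμlim (p + 1) (by omega))).const_mul_atTop
    (by positivity : 0 < σ ^ 2)
  filter_upwards [hμpos p (by omega), hμpos (p + 1) (by omega), hblock, eventually_ge_atTop 1,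
    hsmall.eventually_lt_const hR, hlarge.eventually_gt_atTop R,
    eventually_two_mul_rpow_le (b := s / 2) (by positivity) (hA (p + 1) (by omega))
      (hμpos (p + 1) (by omega)) (hμpos (p + 2) (by omega)) (hμlim (p + 1) (by omega))
      (hμlim (p + 2) (by omega))] with d hμp hμp1 hbl hd hsm hla hgap
  obtain ⟨hκ0, hκR⟩ := hκ d
  have hpos := hlampos d
  have hanti := hlamanti d
  have hnd : (0 : ℝ) < n d := by exact_mod_cast hn d
  have hb : ∀ k ≤ p + 2, ∀ j, vprevNat d k < j → j ≤ vprevNat d (k + 1) →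
      lam d j = μ d k := by
    intro k hk j h1 h2
    refine hbl k hk j ?_ ?_
    · rw [vprev_eq_natCast hd]; exact_mod_cast h1
    · rw [vdim_eq_natCast hd]; exact_mod_cast h2
  have hstep : ∀ k, vprevNat d k < vprevNat d (k + 1) := fun k => by
    rw [vprevNat_succ]; exact Nat.lt_add_of_pos_right (sphDimNat_pos hd k)
  have hfirst : ∀ k ≤ p + 2, lam d (vprevNat d k + 1) = μ d k := fun k hk =>
    hb k hk _ (Nat.lt_succ_self _) (hstep k)
  have hlast : ∀ k ≤ p + 2, lam d (vprevNat d (k + 1)) = μ d k := fun k hk =>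
    hb k hk _ (hstep k) le_rfl
  have hlower : μ d (p + 2) ^ (s / 2) ≤ κstar d := by
    by_contra! hlt
    have h := le_pinskerLHS (σ := σ) (A := vprevNat d (p + 1)) (N := sphDimNat d (p + 1)) hs hκ0
      (hn d) hμp1 hpos (hlamlim d)
      (fun j h1 h2 => hb (p + 1) (by omega) j h1 (by rwa [vprevNat_succ])) (by linarith)
    rw [hκR, mul_div_assoc] at h
    linarith
  have hupper : κstar d < μ d p ^ (s / 2) := by
    by_contra! hle
    have h := pinskerLHS_le (σ := σ) (n := n d) (V := vprevNat d p) hs hκ0 hpos hanti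
      (by rwa [hfirst p (by omega)])
    have hsq : μ d p ^ s ≤ κstar d ^ 2 := by
      calc μ d p ^ s = (μ d p ^ (s / 2)) ^ 2 := by
            rw [← Real.rpow_natCast, ← Real.rpow_mul hμp.le]; congr 1; push_cast; ring
        _ ≤ _ := by gcongr
    have h' : σ ^ 2 * vprevNat d p / (n d * κstar d ^ 2) ≤
        σ ^ 2 * (vprevNat d p / (n d * μ d p ^ s)) := by
      rw [← mul_div_assoc]
      gcongr
    linarith
  refine ⟨hlower, hupper, fun j hj => ?_, ?_⟩
  · rw [vdim_eq_natCast hd] at hj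
    have hj' : vprevNat d (p + 2) + 1 ≤ j := by exact_mod_cast hj
    refine max_one_sub_mul_rpow_neg_eq_zero (hpos j (by omega)) (le_trans ?_ hlower)
    rw [← hfirst (p + 2) le_rfl]
    exact Real.rpow_le_rpow (hpos j (by omega)).le (hanti _ _ (by omega) hj') (by positivity)
  · rw [vdim_eq_natCast hd, vdim_eq_natCast hd]
    rcases le_or_gt (μ d (p + 1) ^ (s / 2)) (κstar d) with h | h
    · left
      rw [blockN_eq hs (Nat.one_le_of_lt (hstep p)) hpos hanti
        (by rwa [hlast p (by omega)]) (by rwa [hfirst (p + 1) (by omega)])]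
    · right
      rw [blockN_eq hs (Nat.one_le_of_lt (hstep (p + 1))) hpos hanti
        (by rwa [hlast (p + 1) (by omega)]) (by rwa [hfirst (p + 2) le_rfl])]
end

section
/- Under the block eigenvalue setup, suppose p(s+1) < γ < p(s+1) + s. Then lim_{d→∞} d^{γ−p} · D*(d) = σ²/(α · p!). -/
open Filter

/-- The sum of the Pinsker weights up to `blockN` equals the sum over any initial segment beyond
which all weights vanish. -/
lemma sum_pinskerEll_blockN {s κ : ℝ} {lam : ℕ → ℝ} (hpos : ∀ j, 1 ≤ j → 0 < lam j)
    {M : ℕ} (hM : ∀ j, M < j → pinskerEll s lam κ j = 0) :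
    ∑ j ∈ Finset.Icc 1 (blockN s lam κ), pinskerEll s lam κ j =
      ∑ i ∈ Finset.range M, pinskerEll s lam κ (i + 1) := by
  have hset : ∀ j ∈ {j : ℕ | 1 ≤ j ∧ κ < lam j ^ (s / 2)}, j ≤ M := by
    rintro j ⟨hj, hlt⟩
    by_contra! hMj
    have h0 := hM j hMj
    have hp : 0 < lam j ^ (s / 2) := Real.rpow_pos_of_pos (hpos j hj) _
    have h1 : κ * lam j ^ (-(s / 2)) < 1 := by
      rw [Real.rpow_neg (hpos j hj).le, ← div_eq_mul_inv, div_lt_one hp]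
      exact hlt
    have h2 := le_max_left (1 - κ * lam j ^ (-(s / 2))) 0
    unfold pinskerEll at h0
    linarith
  have hle : blockN s lam κ ≤ M := csSup_le' hset
  have hsum : ∑ i ∈ Finset.range M, pinskerEll s lam κ (i + 1) =
      ∑ j ∈ Finset.Icc 1 M, pinskerEll s lam κ j := by
    rw [Finset.range_eq_Ico, Finset.sum_Ico_add' (pinskerEll s lam κ) 0 M 1]
    rfl
  rw [hsum]
  refine Finset.sum_subset (Finset.Icc_subset_Icc_right hle) fun j hj hjN => ?_
  rw [Finset.mem_Icc] at hj hjN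
  have hj1 := hj.1
  have hp : 0 < lam j ^ (s / 2) := Real.rpow_pos_of_pos (hpos j hj1) _
  have hnot : ¬ κ < lam j ^ (s / 2) := fun hlt =>
    hjN ⟨hj1, le_csSup ⟨M, hset⟩ ⟨hj1, hlt⟩⟩
  refine max_eq_right ?_
  rw [Real.rpow_neg (hpos j hj1).le, ← div_eq_mul_inv, sub_nonpos,
    one_le_div hp]
  exact not_lt.mp hnot

/-- All but finitely many Pinsker weights vanish when the eigenvalues tend to zero. -/
lemma exists_pinskerEll_eq_zero {s κ : ℝ} (hs : 0 < s) (hκ : 0 < κ) {lam : ℕ → ℝ}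
    (hpos : ∀ j, 1 ≤ j → 0 < lam j) (hlim : Tendsto lam atTop (nhds 0)) :
    ∃ M, ∀ j, M < j → pinskerEll s lam κ j = 0 := by
  have h : Tendsto (fun j => lam j ^ (s / 2)) atTop (nhds 0) := by
    simpa [Real.zero_rpow (half_pos hs).ne'] using
      hlim.rpow_const (p := s / 2) (Or.inr (by positivity))
  obtain ⟨M, hM⟩ := eventually_atTop.mp (h.eventually_lt_const hκ)
  refine ⟨M, fun j hj => max_eq_right ?_⟩
  have hj1 : 1 ≤ j := by omega
  have hp : 0 < lam j ^ (s / 2) := Real.rpow_pos_of_pos (hpos j hj1) _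
  rw [Real.rpow_neg (hpos j hj1).le, ← div_eq_mul_inv, sub_nonpos, one_le_div hp]
  exact (hM j hj.le).le

/-- Two-sided bound on the sum of the Pinsker weights when the spectrum has a gap after index `J`:
`m` is the `J`-th eigenvalue and `m'` bounds the later ones. -/
lemma pinskerD_bounds {s σ R κ : ℝ} (hs : 0 < s) (hR : 0 < R) (hσ : 0 < σ) (hκ : 0 < κ)
    {n : ℕ} (hn : 0 < n) {lam : ℕ → ℝ} (hpos : ∀ j, 1 ≤ j → 0 < lam j)
    (hlim : Tendsto lam atTop (nhds 0))
    (heq : pinskerLHS s σ n lam κ = R) {J : ℕ} {m m' : ℝ} (hm : 0 < m) (hm' : 0 < m')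
    (hJ : ∀ j, 1 ≤ j → j ≤ J → m ≤ lam j) (hJ' : ∀ j, J < j → lam j ≤ m') :
    (J : ℝ) * (1 - (σ ^ 2 / R * (J * m ^ (-s) / n) + (m' / m) ^ (s / 2))) ≤
        ∑ j ∈ Finset.Icc 1 (blockN s lam κ), pinskerEll s lam κ j ∧
      ∑ j ∈ Finset.Icc 1 (blockN s lam κ), pinskerEll s lam κ j ≤
        J + (J * (m' / m) ^ (s / 2) + R / σ ^ 2 * (n * m' ^ s)) := by
  obtain ⟨M₀, hM₀⟩ := exists_pinskerEll_eq_zero hs hκ hpos hlim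
  have hn' : (0 : ℝ) < n := by exact_mod_cast hn
  have hM : ∀ j, J + M₀ < j → pinskerEll s lam κ j = 0 := fun j hj => hM₀ j (by omega)
  have hT : ∑ i ∈ Finset.range (J + M₀),
      lam (i + 1) ^ (-(s / 2)) * pinskerEll s lam κ (i + 1) = R * n * κ / σ ^ 2 := by
    have h : ∑' j : ℕ, lam (j + 1) ^ (-(s / 2)) * max (1 - κ * lam (j + 1) ^ (-(s / 2))) 0 =
        ∑ i ∈ Finset.range (J + M₀), lam (i + 1) ^ (-(s / 2)) * pinskerEll s lam κ (i + 1) := by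
      refine tsum_eq_sum fun i hi => ?_
      rw [Finset.mem_range] at hi
      have := hM (i + 1) (by omega)
      unfold pinskerEll at this
      rw [this, mul_zero]
    rw [← h, ← heq]
    unfold pinskerLHS
    generalize ∑' j : ℕ, lam (j + 1) ^ (-(s / 2)) * max (1 - κ * lam (j + 1) ^ (-(s / 2))) 0 = T
    field_simp
  rw [sum_pinskerEll_blockN hpos hM]
  rw [Finset.sum_range_add] at hT ⊢
  set W := m ^ (-(s / 2)) with hW
  set W' := m' ^ (-(s / 2)) with hW'
  have hWpos : 0 < W := Real.rpow_pos_of_pos hm _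
  have hWpos' : 0 < W' := Real.rpow_pos_of_pos hm' _
  have hratio : (m' / m) ^ (s / 2) = W / W' := by
    rw [hW, hW', Real.div_rpow hm'.le hm.le, Real.rpow_neg hm.le, Real.rpow_neg hm'.le]
    have := Real.rpow_pos_of_pos hm (s / 2)
    have := Real.rpow_pos_of_pos hm' (s / 2)
    field_simp
  have hsq : m ^ (-s) = W ^ 2 := by
    rw [hW, ← Real.rpow_natCast, ← Real.rpow_mul hm.le]; congr 1; push_cast; ring
  have hsq' : m' ^ s = 1 / W' ^ 2 := by
    rw [hW', ← Real.rpow_natCast, ← Real.rpow_mul hm'.le, one_div, ← Real.rpow_neg hm'.le]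
    congr 1; push_cast; ring
  rw [hratio, hsq, hsq']
  have hell0 : ∀ j, 0 ≤ pinskerEll s lam κ j := fun j => le_max_right _ _
  have hw0 : ∀ j, 1 ≤ j → 0 < lam j ^ (-(s / 2)) := fun j hj => Real.rpow_pos_of_pos (hpos j hj) _
  have hell1 : ∀ j, 1 ≤ j → pinskerEll s lam κ j ≤ 1 := fun j hj =>
    max_le (by have := mul_pos hκ (hw0 j hj); linarith) zero_le_one
  have hwle : ∀ j, 1 ≤ j → j ≤ J → lam j ^ (-(s / 2)) ≤ W := fun j hj hjJ =>
    Real.rpow_le_rpow_of_nonpos hm (hJ j hj hjJ) (by linarith)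
  have hwge : ∀ j, J < j → W' ≤ lam j ^ (-(s / 2)) := fun j hj =>
    Real.rpow_le_rpow_of_nonpos (hpos j (by omega)) (hJ' j hj) (by linarith)
  set A := ∑ i ∈ Finset.range J, pinskerEll s lam κ (i + 1)
  set B := ∑ i ∈ Finset.range M₀, pinskerEll s lam κ (J + i + 1)
  set TA := ∑ i ∈ Finset.range J, lam (i + 1) ^ (-(s / 2)) * pinskerEll s lam κ (i + 1)
  set TB := ∑ i ∈ Finset.range M₀, lam (J + i + 1) ^ (-(s / 2)) * pinskerEll s lam κ (J + i + 1)
  have hB0 : 0 ≤ B := Finset.sum_nonneg fun i _ => hell0 _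
  have hTA0 : 0 ≤ TA := Finset.sum_nonneg fun i _ => mul_nonneg (hw0 _ (by omega)).le (hell0 _)
  have hA1 : A ≤ J := by
    have := Finset.sum_le_card_nsmul (Finset.range J) (fun i => pinskerEll s lam κ (i + 1)) 1
      fun i _ => hell1 _ (by omega)
    simpa using this
  have hA2 : J * (1 - κ * W) ≤ A := by
    have := Finset.card_nsmul_le_sum (Finset.range J) (fun i => pinskerEll s lam κ (i + 1))
      (1 - κ * W) fun i hi => by
        have h := mul_le_mul_of_nonneg_left
          (hwle (i + 1) (by omega) (by have := Finset.mem_range.mp hi; omega)) hκ.le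
        exact le_trans (by linarith) (le_max_left _ _)
    simpa using this
  have hTA1 : TA ≤ J * W := by
    have := Finset.sum_le_card_nsmul (Finset.range J)
      (fun i => lam (i + 1) ^ (-(s / 2)) * pinskerEll s lam κ (i + 1)) W
      fun i hi => (mul_le_of_le_one_right (hw0 _ (by omega)).le (hell1 _ (by omega))).trans
        (hwle (i + 1) (by omega) (by have := Finset.mem_range.mp hi; omega))
    simpa using this
  have hTB : W' * B ≤ TB := by
    rw [Finset.mul_sum]
    exact Finset.sum_le_sum fun i _ => mul_le_mul_of_nonneg_right (hwge _ (by omega)) (hell0 _)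
  have hJ0 : (0 : ℝ) ≤ J := Nat.cast_nonneg J
  rcases le_or_gt 1 (κ * W') with hbig | hsmall
  · have hz : ∀ i ∈ Finset.range M₀, pinskerEll s lam κ (J + i + 1) = 0 := fun i _ => by
      have := mul_le_mul_of_nonneg_left (hwge (J + i + 1) (by omega)) hκ.le
      exact max_eq_right (by linarith)
    have hBz : B = 0 := Finset.sum_eq_zero hz
    have hTBz : TB = 0 := Finset.sum_eq_zero fun i hi => by rw [hz i hi, mul_zero]
    have hκle : κ * W ≤ σ ^ 2 / R * (J * W ^ 2 / n) := by
      have h1 : R * n * κ / σ ^ 2 ≤ J * W := by linarith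
      rw [div_le_iff₀ (by positivity)] at h1
      have h2 : σ ^ 2 / R * (J * W ^ 2 / n) = (J * W * σ ^ 2) * (W / (R * n)) := by field_simp
      have h3 : κ * W = (R * n * κ) * (W / (R * n)) := by field_simp
      rw [h2, h3]
      exact mul_le_mul_of_nonneg_right h1 (by positivity)
    have h4 : 0 ≤ W / W' := by positivity
    refine ⟨?_, ?_⟩
    · refine le_trans (mul_le_mul_of_nonneg_left ?_ hJ0) (hA2.trans (by linarith))
      linarith
    · have : 0 ≤ J * (W / W') + R / σ ^ 2 * (n * (1 / W' ^ 2)) := by positivity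
      linarith
  · have hκlt : κ < 1 / W' := by rwa [lt_div_iff₀ hWpos']
    have hκW : κ * W ≤ W / W' := by
      have := mul_le_mul_of_nonneg_right hκlt.le hWpos.le
      rwa [one_div_mul_eq_div] at this
    have h4 : 0 ≤ σ ^ 2 / R * (J * W ^ 2 / n) := by positivity
    refine ⟨?_, ?_⟩
    · refine le_trans (mul_le_mul_of_nonneg_left ?_ hJ0) (hA2.trans (by linarith))
      linarith
    · have h5 : W' * B ≤ R * n * κ / σ ^ 2 := by linarith
      have h6 : R * n * κ / σ ^ 2 ≤ W' * (R / σ ^ 2 * (n * (1 / W' ^ 2))) := by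
        have : W' * (R / σ ^ 2 * (n * (1 / W' ^ 2))) = R * n / σ ^ 2 * (1 / W') := by field_simp
        rw [this, mul_div_right_comm]
        exact mul_le_mul_of_nonneg_left hκlt.le (by positivity)
      have h7 := le_of_mul_le_mul_left (h5.trans h6) hWpos'
      have : 0 ≤ J * (W / W') := by positivity
      linarith

/-- `(k + d - 1)! / (d - 1)!` is asymptotic to `d^k`. -/
lemma tendsto_factorial_ratio (k : ℕ) :
    Tendsto (fun d : ℕ => ((k + d - 1).factorial : ℝ) / (d - 1).factorial / (d : ℝ) ^ k)
      atTop (nhds 1) := by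
  induction k with
  | zero =>
    refine tendsto_const_nhds.congr fun d => ?_
    simp [Nat.factorial_ne_zero]
  | succ k ih =>
    have h : Tendsto (fun d : ℕ => ((k : ℝ) / d + 1)) atTop (nhds 1) := by
      simpa using (tendsto_const_div_atTop_nhds_zero_nat (k : ℝ)).add_const 1
    have := ih.mul h
    rw [one_mul] at this
    refine this.congr' ?_
    filter_upwards [eventually_ge_atTop 1] with d hd
    obtain ⟨e, rfl⟩ : ∃ e, d = e + 1 := ⟨d - 1, by omega⟩
    have h1 : k + 1 + (e + 1) - 1 = (k + e) + 1 := by omega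
    have h2 : k + (e + 1) - 1 = k + e := by omega
    rw [h1, h2, Nat.factorial_succ]
    have : ((e : ℝ) + 1) ≠ 0 := by positivity
    push_cast
    field_simp
    ring

/-- `N(d,k) / d^k → 1 / k!`. -/
lemma tendsto_sphDim_div_pow (k : ℕ) :
    Tendsto (fun d : ℕ => sphDim d k / (d : ℝ) ^ k) atTop (nhds (1 / k.factorial)) := by
  rcases k with _ | k
  · simp [sphDim]
  have h : Tendsto (fun d : ℕ => (((2 * k + 1 : ℝ) / d + 1) / (k + 1).factorial)) atTop
      (nhds (1 / (k + 1).factorial)) := by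
    simpa using ((tendsto_const_div_atTop_nhds_zero_nat (2 * k + 1 : ℝ)).add_const 1).div_const
      ((k + 1).factorial : ℝ)
  have := (tendsto_factorial_ratio k).mul h
  rw [one_mul] at this
  refine this.congr' ?_
  filter_upwards [eventually_ge_atTop 1] with d hd
  have hd0 : (d : ℝ) ≠ 0 := by positivity
  have h1 : k + 1 + d - 2 = k + d - 1 := by omega
  simp only [sphDim, Nat.succ_ne_zero, if_false, h1, Nat.add_sub_cancel, Nat.factorial_succ]
  have : ((k : ℝ) + 1) ≠ 0 := by positivity
  push_cast
  field_simp
  ring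

lemma one_le_sphDim {d : ℕ} (hd : 1 ≤ d) (k : ℕ) : 1 ≤ sphDim d k := by
  rcases k with _ | k
  · simp [sphDim]
  have hd' : (1 : ℝ) ≤ d := by exact_mod_cast hd
  have h1 : k + 1 + d - 2 = (d - 1) + k := by omega
  simp only [sphDim, Nat.succ_ne_zero, if_false, h1, Nat.add_sub_cancel]
  have h2 : (((d - 1).factorial : ℝ) * k.factorial) ≤ ((d - 1) + k).factorial := by
    exact_mod_cast Nat.le_of_dvd (Nat.factorial_pos _)
      (Nat.factorial_mul_factorial_dvd_factorial_add (d - 1) k)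
  rw [one_le_div (by positivity)]
  refine h2.trans (le_mul_of_one_le_left (by positivity) ?_)
  rw [one_le_div (by positivity)]
  push_cast
  have : (0 : ℝ) ≤ k := Nat.cast_nonneg k
  linarith

/-- `v_p(d) / d^p → 1 / p!`. -/
lemma tendsto_vdim_div_pow (p : ℕ) :
    Tendsto (fun d : ℕ => vdim d p / (d : ℝ) ^ p) atTop (nhds (1 / p.factorial)) := by
  have hlow : ∀ k ∈ Finset.range p,
      Tendsto (fun d : ℕ => sphDim d k / (d : ℝ) ^ p) atTop (nhds 0) := by
    intro k hk
    have hk := Finset.mem_range.mp hk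
    have h : Tendsto (fun d : ℕ => ((d : ℝ)⁻¹) ^ (p - k)) atTop (nhds 0) := by
      simpa [zero_pow (show p - k ≠ 0 by omega)] using
        (tendsto_inv_atTop_nhds_zero_nat (𝕜 := ℝ)).pow (p - k)
    have := (tendsto_sphDim_div_pow k).mul h
    rw [mul_zero] at this
    refine this.congr' ?_
    filter_upwards [eventually_ge_atTop 1] with d hd
    have hd0 : (d : ℝ) ≠ 0 := by positivity
    obtain ⟨e, rfl⟩ : ∃ e, p = k + e := ⟨p - k, by omega⟩
    rw [Nat.add_sub_cancel_left, pow_add, inv_pow]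
    field_simp
  have := (tendsto_finsetSum _ hlow).add (tendsto_sphDim_div_pow p)
  rw [Finset.sum_const_zero, zero_add] at this
  refine this.congr fun d => ?_
  rw [vdim, Finset.sum_range_succ, add_div, Finset.sum_div]

lemma tendsto_floor_vdim_div_pow (p : ℕ) :
    Tendsto (fun d : ℕ => (⌊vdim d p⌋₊ : ℝ) / (d : ℝ) ^ p) atTop (nhds (1 / p.factorial)) := by
  rcases Nat.eq_zero_or_pos p with rfl | hp
  · simp [vdim, sphDim]
  have h : Tendsto (fun d : ℕ => ((d : ℝ)⁻¹) ^ p) atTop (nhds 0) := by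
    simpa [zero_pow hp.ne'] using (tendsto_inv_atTop_nhds_zero_nat (𝕜 := ℝ)).pow p
  have hlow := (tendsto_vdim_div_pow p).sub h
  rw [sub_zero] at hlow
  refine tendsto_of_tendsto_of_tendsto_of_le_of_le' hlow (tendsto_vdim_div_pow p) ?_ ?_
  · filter_upwards [eventually_ge_atTop 1] with d hd
    have hd0 : (0 : ℝ) < d := by positivity
    rw [inv_pow, ← one_div, ← sub_div]
    gcongr
    exact (Nat.sub_one_lt_floor _).le
  · filter_upwards [eventually_ge_atTop 1] with d hd
    have : 0 ≤ vdim d p := Finset.sum_nonneg fun k _ => zero_le_one.trans (one_le_sphDim hd k)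
    gcongr
    exact Nat.floor_le this

/-- If `p(s+1) < γ < p(s+1) + s` then `d^{γ−p} · D*(d) → σ²/(α p!)`. -/
theorem statement11
    (s R σ α γ : ℝ) (hs : 0 < s) (hR : 0 < R) (hσ : 0 < σ) (hα : 0 < α) (hγ : 0 < γ)
    (p : ℕ) (hp : p = ⌊γ / (s + 1)⌋₊)
    (a : ℕ → ℝ) (ha : ∀ k ≤ p + 3, 0 < a k)
    (n : ℕ → ℕ) (hn : ∀ d, 0 < n d)
    (hnlim : Tendsto (fun d : ℕ => (n d : ℝ) / (d : ℝ) ^ γ) atTop (nhds α))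
    (μ : ℕ → ℕ → ℝ)
    (hμlim : ∀ k ≤ p + 3, Tendsto (fun d : ℕ => (d : ℝ) ^ k * μ d k) atTop
      (nhds (a k * Nat.factorial k)))
    (hμorder : ∀ᶠ d in atTop, (∀ k < p + 2, μ d (k + 1) < μ d k) ∧ 0 < μ d (p + 2))
    (lam : ℕ → ℕ → ℝ)
    (hlampos : ∀ d j, 1 ≤ j → 0 < lam d j)
    (hlamanti : ∀ d i j, 1 ≤ i → i ≤ j → lam d j ≤ lam d i)
    (hlamlim : ∀ d, Tendsto (lam d) atTop (nhds 0))
    (hblock : ∀ᶠ d in atTop, ∀ k ≤ p + 2, ∀ j : ℕ,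
      vprev d k < (j : ℝ) → (j : ℝ) ≤ vdim d k → lam d j = μ d k)
    (κstar : ℕ → ℝ)
    (hκ : ∀ d, 0 < κstar d ∧ pinskerLHS s σ (n d) (lam d) (κstar d) = R)
    (h1 : (p : ℝ) * (s + 1) < γ) (h2 : γ < (p : ℝ) * (s + 1) + s) :
    Tendsto (fun d : ℕ => (d : ℝ) ^ (γ - (p : ℝ)) * pinskerD s σ (n d) (lam d) (κstar d))
      atTop (nhds (σ ^ 2 / (α * Nat.factorial p))) := by
  have hs1 : (0 : ℝ) < s / 2 := half_pos hs
  have hbounds : ∀ᶠ d in atTop, 1 ≤ d ∧ 0 < μ d p ∧ 0 < μ d (p + 1) ∧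
      ((⌊vdim d p⌋₊ : ℝ) * (1 - (σ ^ 2 / R * (⌊vdim d p⌋₊ * μ d p ^ (-s) / n d) +
          (μ d (p + 1) / μ d p) ^ (s / 2))) ≤
        ∑ j ∈ Finset.Icc 1 (blockN s (lam d) (κstar d)), pinskerEll s (lam d) (κstar d) j ∧
      ∑ j ∈ Finset.Icc 1 (blockN s (lam d) (κstar d)), pinskerEll s (lam d) (κstar d) j ≤
        ⌊vdim d p⌋₊ + (⌊vdim d p⌋₊ * (μ d (p + 1) / μ d p) ^ (s / 2) +
          R / σ ^ 2 * (n d * μ d (p + 1) ^ s))) := by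
    filter_upwards [eventually_ge_atTop 1, hμorder, hblock] with d hd hord hbl
    have hm' : 0 < μ d (p + 1) := hord.2.trans (hord.1 (p + 1) (by omega))
    have hm : 0 < μ d p := hm'.trans (hord.1 p (by omega))
    have hsucc : ∀ k, vdim d k = vprev d k + sphDim d k := fun k => Finset.sum_range_succ _ _
    have hprev0 : 0 ≤ vprev d p :=
      Finset.sum_nonneg fun k _ => zero_le_one.trans (one_le_sphDim hd k)
    have hN := one_le_sphDim hd p
    have hN' := one_le_sphDim hd (p + 1)
    have hv1 : 1 ≤ vdim d p := by rw [hsucc]; linarith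
    have hfl : (⌊vdim d p⌋₊ : ℝ) ≤ vdim d p := Nat.floor_le (by linarith)
    have hfl' : vdim d p < ⌊vdim d p⌋₊ + 1 := Nat.lt_floor_add_one _
    have hJ : lam d ⌊vdim d p⌋₊ = μ d p := by
      refine hbl p (by omega) _ ?_ hfl
      rw [hsucc] at hfl'
      rw [hsucc]
      linarith
    have hJ' : lam d (⌊vdim d p⌋₊ + 1) = μ d (p + 1) := by
      refine hbl (p + 1) (by omega) _ ?_ ?_
      · push_cast
        exact hfl'
      · have : vdim d (p + 1) = vdim d p + sphDim d (p + 1) := hsucc (p + 1)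
        push_cast
        linarith
    refine ⟨hd, hm, hm', pinskerD_bounds hs hR hσ (hκ d).1 (hn d) (hlampos d)
      (hlamlim d) (hκ d).2 hm hm' ?_ ?_⟩
    · intro j hj hjJ
      rw [← hJ]
      exact hlamanti d j _ hj hjJ
    · intro j hj
      rw [← hJ']
      exact hlamanti d _ j (by omega) hj
  have hpow : ∀ e : ℝ, e < 0 → Tendsto (fun d : ℕ => (d : ℝ) ^ e) atTop (nhds 0) := fun e he => by
    simpa [Function.comp_def] using (tendsto_rpow_neg_atTop (neg_pos.mpr he)).comp tendsto_natCast_atTop_atTop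
  have hv := tendsto_floor_vdim_div_pow p
  have hμp := hμlim p (by omega)
  have hμp' := hμlim (p + 1) (by omega)
  have hap : 0 < a p * p.factorial := mul_pos (ha p (by omega)) (by positivity)
  have hninv : Tendsto (fun d : ℕ => (d : ℝ) ^ γ / n d) atTop (nhds (1 / α)) := by
    simpa using hnlim.inv₀ hα.ne'
  have hgap : Tendsto (fun d : ℕ => (μ d (p + 1) / μ d p) ^ (s / 2)) atTop (nhds 0) := by
    have h : Tendsto (fun d : ℕ => μ d (p + 1) / μ d p) atTop (nhds 0) := by
      have := (hμp'.div hμp hap.ne').mul (tendsto_inv_atTop_nhds_zero_nat (𝕜 := ℝ))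
      rw [mul_zero] at this
      refine this.congr' ?_
      filter_upwards [hbounds] with d hd
      have hd0 : (0 : ℝ) < d := by exact_mod_cast hd.1
      have := hd.2.1
      simp only [Pi.div_apply]
      field_simp
      ring
    simpa [Real.zero_rpow hs1.ne'] using h.rpow_const (p := s / 2) (Or.inr hs1.le)
  have hbias : Tendsto (fun d : ℕ => (⌊vdim d p⌋₊ : ℝ) * μ d p ^ (-s) / n d) atTop (nhds 0) := by
    have := ((hv.mul (hμp.rpow_const (p := -s) (Or.inl hap.ne'))).mul hninv).mul
      (hpow (p + p * s - γ) (by linarith))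
    rw [mul_zero] at this
    refine this.congr' ?_
    filter_upwards [hbounds] with d hd
    have hd0 : (0 : ℝ) < d := by exact_mod_cast hd.1
    have hn0 : (0 : ℝ) < n d := by exact_mod_cast hn d
    rw [Real.mul_rpow (by positivity) hd.2.1.le, ← Real.rpow_natCast, ← Real.rpow_mul hd0.le,
      Real.rpow_sub hd0, Real.rpow_add hd0, mul_neg, Real.rpow_neg hd0.le]
    have := Real.rpow_pos_of_pos hd0 (p : ℝ)
    have := Real.rpow_pos_of_pos hd0 ((p : ℝ) * s)
    have := Real.rpow_pos_of_pos hd0 γ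
    field_simp
  have htail : Tendsto (fun d : ℕ => (n d * μ d (p + 1) ^ s) / (d : ℝ) ^ p) atTop (nhds 0) := by
    have := (hnlim.mul (hμp'.rpow_const (p := s) (Or.inr hs.le))).mul
      (hpow (γ - (p + 1) * s - p) (by linarith))
    rw [mul_zero] at this
    refine this.congr' ?_
    filter_upwards [hbounds] with d hd
    have hd0 : (0 : ℝ) < d := by exact_mod_cast hd.1
    rw [Real.mul_rpow (by positivity) hd.2.2.1.le, ← Real.rpow_natCast, ← Real.rpow_mul hd0.le,
      Real.rpow_sub hd0, Real.rpow_sub hd0, ← Real.rpow_natCast (d : ℝ) p]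
    push_cast
    have := Real.rpow_pos_of_pos hd0 (p : ℝ)
    have := Real.rpow_pos_of_pos hd0 (((p : ℝ) + 1) * s)
    have := Real.rpow_pos_of_pos hd0 γ
    field_simp
  have hsum : Tendsto (fun d : ℕ =>
      (∑ j ∈ Finset.Icc 1 (blockN s (lam d) (κstar d)), pinskerEll s (lam d) (κstar d) j) /
        (d : ℝ) ^ p) atTop (nhds (1 / p.factorial)) := by
    have hlo := hv.mul (((hbias.const_mul (σ ^ 2 / R)).add hgap).const_sub 1)
    have hup := hv.add ((hv.mul hgap).add (htail.const_mul (R / σ ^ 2)))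
    simp only [mul_zero, add_zero, sub_zero, mul_one] at hlo hup
    refine tendsto_of_tendsto_of_tendsto_of_le_of_le' hlo hup ?_ ?_
    · filter_upwards [hbounds] with d hd
      have hd0 : (0 : ℝ) < d := by exact_mod_cast hd.1
      rw [div_mul_eq_mul_div]
      exact div_le_div_of_nonneg_right hd.2.2.2.1 (by positivity)
    · filter_upwards [hbounds] with d hd
      have hd0 : (0 : ℝ) < d := by exact_mod_cast hd.1
      refine (div_le_div_of_nonneg_right hd.2.2.2.2 (by positivity)).trans_eq ?_
      ring
  have hmain := (hninv.mul hsum).const_mul (σ ^ 2)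
  have hval : σ ^ 2 * (1 / α * (1 / (p.factorial : ℝ))) = σ ^ 2 / (α * p.factorial) := by
    field_simp
  rw [hval] at hmain
  refine hmain.congr' ?_
  filter_upwards [eventually_ge_atTop 1] with d hd
  have hd0 : (0 : ℝ) < d := by exact_mod_cast hd
  have hn0 : (0 : ℝ) < n d := by exact_mod_cast hn d
  rw [pinskerD, Real.rpow_sub hd0, Real.rpow_natCast]
  field_simp
end

section
/- Under the block eigenvalue setup, suppose p(s+1) + s < γ < (p+1)(s+1). Then lim_{d→∞} d^{(p+1)s} · D*(d) = R · a_{p+1}^s · ((p+1)!)^s. -/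
open Filter

/-- `f d ~ c · d ^ e`, expressed as convergence of the quotient `f d / d ^ e` to `c`. -/
def HasPowerOrder (f : ℕ → ℝ) (e c : ℝ) : Prop :=
  Tendsto (fun d : ℕ => f d / (d : ℝ) ^ e) atTop (nhds c)

namespace HasPowerOrder

variable {f g : ℕ → ℝ} {e e' c c' : ℝ}

lemma mul (hf : HasPowerOrder f e c) (hg : HasPowerOrder g e' c') :
    HasPowerOrder (fun d => f d * g d) (e + e') (c * c') := by
  refine (Tendsto.mul hf hg).congr' ?_
  filter_upwards [eventually_gt_atTop 0] with d hd
  have hd' : (0 : ℝ) < d := by exact_mod_cast hd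
  rw [Real.rpow_add hd']
  have := Real.rpow_pos_of_pos hd' e
  have := Real.rpow_pos_of_pos hd' e'
  field_simp

lemma inv (hf : HasPowerOrder f e c) (hc : c ≠ 0) :
    HasPowerOrder (fun d => (f d)⁻¹) (-e) c⁻¹ := by
  refine (Tendsto.inv₀ hf hc).congr' ?_
  filter_upwards [eventually_gt_atTop 0] with d hd
  have hd' : (0 : ℝ) < d := by exact_mod_cast hd
  rw [Real.rpow_neg hd'.le, inv_div, div_inv_eq_mul, div_eq_mul_inv, mul_comm]

lemma div (hf : HasPowerOrder f e c) (hg : HasPowerOrder g e' c') (hc : c' ≠ 0) :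
    HasPowerOrder (fun d => f d / g d) (e - e') (c / c') := by
  simpa only [div_eq_mul_inv, sub_eq_add_neg] using hf.mul (hg.inv hc)

lemma rpow_self (e : ℝ) : HasPowerOrder (fun d : ℕ => (d : ℝ) ^ e) e 1 := by
  refine tendsto_const_nhds.congr' ?_
  filter_upwards [eventually_gt_atTop 0] with d hd
  have hd' : (0 : ℝ) < d := by exact_mod_cast hd
  exact (div_self (Real.rpow_pos_of_pos hd' e).ne').symm

lemma tendsto_zero (hf : HasPowerOrder f e c) (he : e < 0) : Tendsto f atTop (nhds 0) := by
  have h : Tendsto (fun d : ℕ => (d : ℝ) ^ e) atTop (nhds 0) := by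
    simpa [Function.comp_def] using
      (tendsto_rpow_neg_atTop (neg_pos.2 he)).comp tendsto_natCast_atTop_atTop
  have := Tendsto.mul hf h
  rw [mul_zero] at this
  refine this.congr' ?_
  filter_upwards [eventually_gt_atTop 0] with d hd
  have hd' : (0 : ℝ) < d := by exact_mod_cast hd
  exact div_mul_cancel₀ _ (Real.rpow_pos_of_pos hd' e).ne'

lemma tendsto_atTop (hf : HasPowerOrder f e c) (he : 0 < e) (hc : 0 < c) :
    Tendsto f atTop atTop := by
  have h : Tendsto (fun d : ℕ => (d : ℝ) ^ e) atTop atTop :=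
    (tendsto_rpow_atTop he).comp tendsto_natCast_atTop_atTop
  refine (Tendsto.pos_mul_atTop hc hf h).congr' ?_
  filter_upwards [eventually_gt_atTop 0] with d hd
  have hd' : (0 : ℝ) < d := by exact_mod_cast hd
  exact div_mul_cancel₀ _ (Real.rpow_pos_of_pos hd' e).ne'

lemma eventually_pos (hf : HasPowerOrder f e c) (hc : 0 < c) : ∀ᶠ d in atTop, 0 < f d := by
  filter_upwards [Tendsto.eventually_const_lt hc hf, eventually_gt_atTop 0] with d h hd
  have hd' : (0 : ℝ) < d := by exact_mod_cast hd
  exact (div_pos_iff_of_pos_right (Real.rpow_pos_of_pos hd' e)).1 h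

lemma sub_of_lt (hf : HasPowerOrder f e c) (hg : HasPowerOrder g e' c') (he : e' < e) :
    HasPowerOrder (fun d => f d - g d) e c := by
  have h := (hg.div (rpow_self e) one_ne_zero).tendsto_zero (sub_neg.2 he)
  simpa only [HasPowerOrder, sub_div, sub_zero] using Tendsto.sub hf h

lemma add_of_lt (hf : HasPowerOrder f e c) (hg : HasPowerOrder g e' c') (he : e < e') :
    HasPowerOrder (fun d => f d + g d) e' c' := by
  have h := (hf.div (rpow_self e') one_ne_zero).tendsto_zero (sub_neg.2 he)
  simpa only [HasPowerOrder, add_div, zero_add] using Tendsto.add h hg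

lemma rpow_const {t : ℝ} (hf : HasPowerOrder f e c) (hc : 0 < c) :
    HasPowerOrder (fun d => f d ^ t) (e * t) (c ^ t) := by
  refine (Tendsto.rpow_const hf (p := t) (Or.inl hc.ne')).congr' ?_
  filter_upwards [eventually_gt_atTop 0, hf.eventually_pos hc] with d hd hfd
  have hd' : (0 : ℝ) < d := by exact_mod_cast hd
  rw [Real.div_rpow hfd.le (Real.rpow_nonneg hd'.le _), Real.rpow_mul hd'.le]

end HasPowerOrder

lemma hasPowerOrder_factorial_ratio (m : ℕ) :
    HasPowerOrder (fun d => ((m + d - 1).factorial : ℝ) / ((d - 1).factorial : ℝ)) m 1 := by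
  induction m with
  | zero =>
    refine tendsto_const_nhds.congr' ?_
    filter_upwards with d
    have : ((d - 1).factorial : ℝ) ≠ 0 := by positivity
    simp [this]
  | succ m ih =>
    have h : HasPowerOrder (fun d : ℕ => (m : ℝ) + d) 1 1 := by
      refine HasPowerOrder.add_of_lt (e := 0) (c := m) ?_ ?_ one_pos
      · simp [HasPowerOrder]
      · simpa using HasPowerOrder.rpow_self 1
    have h2 := ih.mul h
    rw [one_mul] at h2
    push_cast
    refine Tendsto.congr' ?_ h2
    filter_upwards [eventually_gt_atTop 0] with d hd
    have : (m + 1 + d - 1).factorial = (m + d) * (m + d - 1).factorial := by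
      rw [show m + 1 + d - 1 = (m + d - 1) + 1 by omega, Nat.factorial_succ,
        show m + d - 1 + 1 = m + d by omega]
    rw [this]
    push_cast
    ring

lemma hasPowerOrder_sphDim (k : ℕ) :
    HasPowerOrder (fun d => sphDim d k) k (1 / (k.factorial : ℝ)) := by
  rcases k with _ | m
  · simp [HasPowerOrder, sphDim]
  · have h : HasPowerOrder (fun d : ℕ => (2 * ((m + 1 : ℕ) : ℝ) - 1) + d) 1 1 := by
      refine HasPowerOrder.add_of_lt (e := 0) (c := 2 * ((m + 1 : ℕ) : ℝ) - 1) ?_ ?_ one_pos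
      · simp [HasPowerOrder]
      · simpa using HasPowerOrder.rpow_self 1
    have hc : HasPowerOrder (fun _ => 1 / ((m + 1).factorial : ℝ)) 0
        (1 / ((m + 1).factorial : ℝ)) := by
      simp [HasPowerOrder]
    have h2 := ((hasPowerOrder_factorial_ratio m).mul h).mul hc
    rw [one_mul, one_mul, add_zero] at h2
    rw [Nat.cast_succ]
    refine Tendsto.congr' ?_ h2
    filter_upwards with d
    rw [sphDim, if_neg (Nat.succ_ne_zero m), show m + 1 + d - 2 = m + d - 1 by omega,
      Nat.factorial_succ, Nat.add_sub_cancel]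
    push_cast
    have h3 : ((d - 1).factorial : ℝ) ≠ 0 := by positivity
    have h4 : (m.factorial : ℝ) ≠ 0 := by positivity
    have h5 : (m : ℝ) + 1 ≠ 0 := by positivity
    congr 1
    field_simp
    ring

lemma vdim_succ (d k : ℕ) : vdim d (k + 1) = vdim d k + sphDim d (k + 1) :=
  Finset.sum_range_succ _ _

lemma vdim_eq_vprev_add (d k : ℕ) : vdim d k = vprev d k + sphDim d k :=
  Finset.sum_range_succ _ _

lemma vprev_nonneg {d : ℕ} (hd : 1 ≤ d) (k : ℕ) : 0 ≤ vprev d k :=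
  Finset.sum_nonneg fun i _ => zero_le_one.trans (one_le_sphDim hd i)

lemma hasPowerOrder_vdim (k : ℕ) :
    HasPowerOrder (fun d => vdim d k) k (1 / (k.factorial : ℝ)) := by
  induction k with
  | zero => simp [HasPowerOrder, vdim, sphDim]
  | succ k ih =>
    simp only [vdim_succ]
    exact ih.add_of_lt (hasPowerOrder_sphDim (k + 1)) (by push_cast; linarith)

lemma vprev_lt_floor_vdim {d : ℕ} (hd : 1 ≤ d) (k : ℕ) : vprev d k < (⌊vdim d k⌋₊ : ℝ) := by
  have h1 := Nat.lt_floor_add_one (vdim d k)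
  have h2 := one_le_sphDim hd k
  have h3 := vdim_eq_vprev_add d k
  linarith

lemma floor_vdim_le {d : ℕ} (hd : 1 ≤ d) (k : ℕ) : (⌊vdim d k⌋₊ : ℝ) ≤ vdim d k := by
  refine Nat.floor_le ?_
  have := vprev_nonneg hd k
  have h2 := one_le_sphDim hd k
  have h3 := vdim_eq_vprev_add d k
  linarith

/-- Both Pinsker sums are sums over a common finite range, which may be taken arbitrarily long. -/
lemma exists_pinsker_truncation {s κ : ℝ} (hs : 0 < s) (hκ : 0 < κ) {lam : ℕ → ℝ}
    (hpos : ∀ j, 1 ≤ j → 0 < lam j) (hlim : Tendsto lam atTop (nhds 0)) (σ : ℝ) (n B : ℕ) :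
    ∃ M ≥ B,
      pinskerLHS s σ n lam κ = σ ^ 2 / (n * κ) *
        ∑ j ∈ Finset.Ioc 0 M, lam j ^ (-(s / 2)) * max (1 - κ * lam j ^ (-(s / 2))) 0 ∧
      pinskerD s σ n lam κ = σ ^ 2 / n *
        ∑ j ∈ Finset.Ioc 0 M, max (1 - κ * lam j ^ (-(s / 2))) 0 := by
  have hiff : ∀ j, 1 ≤ j → (κ < lam j ^ (s / 2) ↔ κ * lam j ^ (-(s / 2)) < 1) := by
    intro j hj
    rw [Real.rpow_neg (hpos j hj).le, ← div_eq_mul_inv,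
      div_lt_one (Real.rpow_pos_of_pos (hpos j hj) _)]
  have hlim' : Tendsto (fun j => lam j ^ (s / 2)) atTop (nhds 0) := by
    have := hlim.rpow_const (p := s / 2) (Or.inr (by positivity))
    rwa [Real.zero_rpow (by positivity)] at this
  obtain ⟨M₀, hM₀⟩ := eventually_atTop.1 (hlim'.eventually_lt_const hκ)
  have hzero : ∀ j, 1 ≤ j → ¬ κ < lam j ^ (s / 2) →
      max (1 - κ * lam j ^ (-(s / 2))) 0 = 0 := by
    intro j hj h
    rw [hiff j hj, not_lt] at h
    exact max_eq_right (by linarith)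
  refine ⟨max B M₀, le_max_left _ _, ?_, ?_⟩
  · rw [pinskerLHS, tsum_eq_sum (s := Finset.range (max B M₀))]
    · congr 1
      rw [Finset.range_eq_Ico, Finset.sum_Ico_add' (fun j => lam j ^ (-(s / 2)) *
        max (1 - κ * lam j ^ (-(s / 2))) 0), ← Finset.Ico_add_one_add_one_eq_Ioc]
    · intro j hj
      rw [Finset.mem_range, not_lt] at hj
      rw [hzero (j + 1) (by omega)
        (hM₀ (j + 1) (by have := le_max_right B M₀; omega)).not_gt, mul_zero]
  · rw [pinskerD]
    congr 1
    have hbdd : M₀ ∈ upperBounds {j : ℕ | 1 ≤ j ∧ κ < lam j ^ (s / 2)} := by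
      rintro j ⟨-, hj⟩
      by_contra! h
      exact absurd hj (hM₀ j h.le).not_gt
    have hN : blockN s lam κ ≤ M₀ := csSup_le' hbdd
    refine Finset.sum_subset ?_ ?_
    · intro j hj
      rw [Finset.mem_Icc] at hj
      rw [Finset.mem_Ioc]
      exact ⟨hj.1, hj.2.trans (hN.trans (le_max_right _ _))⟩
    · intro j hj hj'
      rw [Finset.mem_Ioc] at hj
      refine hzero j hj.1 fun h => hj' (Finset.mem_Icc.2 ⟨hj.1, ?_⟩)
      exact le_csSup ⟨M₀, hbdd⟩ ⟨hj.1, h⟩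

section BlockSums

variable {w : ℕ → ℝ} {κ Wp Wq Wr : ℝ} {A B M : ℕ}

lemma sum_Ioc_eq_blocks (hAB : A ≤ B) (hBM : B ≤ M) {f : ℕ → ℝ} {c : ℝ}
    (hmid : ∀ j, A < j → j ≤ B → f j = c) (htail : ∀ j, B < j → f j = 0) :
    ∑ j ∈ Finset.Ioc 0 M, f j = ∑ j ∈ Finset.Ioc 0 A, f j + (B - A : ℝ) * c := by
  rw [← Finset.sum_Ioc_consecutive f (Nat.zero_le B) hBM,
    ← Finset.sum_Ioc_consecutive f (Nat.zero_le A) hAB,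
    Finset.sum_congr rfl (g := fun _ => c) (s₁ := Finset.Ioc A B)
      (fun j hj => hmid j (Finset.mem_Ioc.1 hj).1 (Finset.mem_Ioc.1 hj).2),
    Finset.sum_eq_zero (s := Finset.Ioc B M) (fun j hj => htail j (Finset.mem_Ioc.1 hj).1)]
  simp [Nat.cast_sub hAB]

lemma max_one_sub_le_one {x : ℝ} (hx : 0 ≤ x) : max (1 - x) 0 ≤ 1 :=
  max_le (by linarith) zero_le_one

lemma sum_head_le (hκ : 0 < κ) (hw : ∀ j, 1 ≤ j → 0 < w j) (hhead : ∀ j, 1 ≤ j → j ≤ A → w j ≤ Wp) :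
    ∑ j ∈ Finset.Ioc 0 A, w j * max (1 - κ * w j) 0 ≤ A * Wp := by
  have h : ∀ j ∈ Finset.Ioc 0 A, w j * max (1 - κ * w j) 0 ≤ Wp := by
    intro j hj
    rw [Finset.mem_Ioc] at hj
    have hj1 := hw j hj.1
    exact (mul_le_of_le_one_right hj1.le (max_one_sub_le_one (by positivity))).trans
      (hhead j hj.1 hj.2)
  simpa using Finset.sum_le_card_nsmul _ _ _ h

lemma sum_head_nonneg (hw : ∀ j, 1 ≤ j → 0 < w j) :
    0 ≤ ∑ j ∈ Finset.Ioc 0 A, w j * max (1 - κ * w j) 0 :=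
  Finset.sum_nonneg fun j hj =>
    mul_nonneg (hw j (Finset.mem_Ioc.1 hj).1).le (le_max_right _ _)

lemma sum_weights_head_le (hκ : 0 < κ) (hw : ∀ j, 1 ≤ j → 0 < w j) :
    ∑ j ∈ Finset.Ioc 0 A, max (1 - κ * w j) 0 ≤ A := by
  have h : ∀ j ∈ Finset.Ioc 0 A, max (1 - κ * w j) 0 ≤ 1 := by
    intro j hj
    have hj1 := hw j (Finset.mem_Ioc.1 hj).1
    exact max_one_sub_le_one (by positivity)
  simpa using Finset.sum_le_card_nsmul _ _ _ h

lemma middle_le_sum (hAB : A ≤ B) (hBM : B ≤ M) (hw : ∀ j, 1 ≤ j → 0 < w j)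
    (hmid : ∀ j, A < j → j ≤ B → w j = Wq) (hWq : 0 < Wq) :
    (B - A : ℝ) * (Wq * (1 - κ * Wq)) ≤
      ∑ j ∈ Finset.Ioc 0 M, w j * max (1 - κ * w j) 0 := by
  have hsub : Finset.Ioc A B ⊆ Finset.Ioc 0 M := Finset.Ioc_subset_Ioc (Nat.zero_le _) hBM
  have h : ∀ j ∈ Finset.Ioc A B, Wq * (1 - κ * Wq) ≤ w j * max (1 - κ * w j) 0 := by
    intro j hj
    rw [Finset.mem_Ioc] at hj
    rw [hmid j hj.1 hj.2]
    exact mul_le_mul_of_nonneg_left (le_max_left _ _) hWq.le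
  have h1 := Finset.card_nsmul_le_sum _ _ _ h
  rw [Nat.card_Ioc, nsmul_eq_mul, Nat.cast_sub hAB] at h1
  exact h1.trans (Finset.sum_le_sum_of_subset_of_nonneg hsub fun j hj _ =>
    mul_nonneg (hw j (Finset.mem_Ioc.1 hj).1).le (le_max_right _ _))

end BlockSums

/-- A decomposition of the Pinsker equation when the weights have one block `(A, B]` with constant
weight `Wq`, preceded by weights at most `Wp` and followed by weights at least `Wr`. -/
lemma pinsker_block_estimates {s σ R κ : ℝ} {n : ℕ} {lam : ℕ → ℝ} {A B : ℕ} {Wp Wq Wr : ℝ}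
    (hs : 0 < s) (hσ : 0 < σ) (hn : 0 < n) (hκ : 0 < κ)
    (hpos : ∀ j, 1 ≤ j → 0 < lam j) (hlim : Tendsto lam atTop (nhds 0))
    (hR : pinskerLHS s σ n lam κ = R) (hAB : A ≤ B) (hWp : 0 < Wp) (hWq : 0 < Wq) (hWr : Wq ≤ Wr)
    (hhead : ∀ j, 1 ≤ j → j ≤ A → lam j ^ (-(s / 2)) ≤ Wp)
    (hmid : ∀ j, A < j → j ≤ B → lam j ^ (-(s / 2)) = Wq)
    (htail : ∀ j, B < j → Wr ≤ lam j ^ (-(s / 2))) :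
    (1 ≤ κ * Wq → R ≤ σ ^ 2 * (A * Wp * Wq / n)) ∧
    (κ * Wq < 1 → (B - A : ℝ) * Wq ^ 2 * (1 - κ * Wq) * σ ^ 2 ≤ R * n) ∧
    (1 ≤ κ * Wr → |pinskerD s σ n lam κ - R * (κ * Wq) / Wq ^ 2| ≤
      σ ^ 2 * (A / n) + σ ^ 2 * (A * Wp * Wq / n) / Wq ^ 2) := by
  obtain ⟨M, hBM, hL, hD⟩ := exists_pinsker_truncation hs hκ hpos hlim σ n B
  set w : ℕ → ℝ := fun j => lam j ^ (-(s / 2))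
  change ∀ j, A < j → j ≤ B → w j = Wq at hmid
  have hw : ∀ j, 1 ≤ j → 0 < w j := fun j hj => Real.rpow_pos_of_pos (hpos j hj) _
  have hn' : (0 : ℝ) < n := by exact_mod_cast hn
  have hzero : ∀ j, 1 ≤ κ * w j → max (1 - κ * w j) 0 = 0 :=
    fun j hj => max_eq_right (by linarith)
  have htail_zero : 1 ≤ κ * Wr → ∀ j, B < j → max (1 - κ * w j) 0 = 0 := fun h j hj =>
    hzero j (h.trans (mul_le_mul_of_nonneg_left (htail j hj) hκ.le))
  have hS : ∑ j ∈ Finset.Ioc 0 M, w j * max (1 - κ * w j) 0 = R * (n * κ) / σ ^ 2 := by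
    rw [← hR, hL, div_mul_eq_mul_div, div_mul_cancel₀ _ (by positivity),
      mul_div_cancel_left₀ _ (by positivity)]
  have hhead_le := sum_head_le (w := w) (A := A) hκ hw hhead
  have hhead_nonneg := sum_head_nonneg (w := w) (A := A) (κ := κ) hw
  refine ⟨fun h => ?_, fun h => ?_, fun h => ?_⟩
  · have h' : 1 ≤ κ * Wr := h.trans (mul_le_mul_of_nonneg_left hWr hκ.le)
    rw [sum_Ioc_eq_blocks (c := 0) hAB hBM (fun j hj hj' => by
        rw [hzero j (by rwa [hmid j hj hj']), mul_zero])
      (fun j hj => by rw [htail_zero h' j hj, mul_zero]), mul_zero, add_zero] at hS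
    rw [hS, div_le_iff₀ (by positivity)] at hhead_le
    have h1 : R * n * κ ≤ (A * Wp * σ ^ 2 * Wq) * κ := by
      calc R * n * κ = R * (n * κ) := by ring
        _ ≤ A * Wp * σ ^ 2 := hhead_le
        _ ≤ A * Wp * σ ^ 2 * (κ * Wq) := le_mul_of_one_le_right (by positivity) h
        _ = _ := by ring
    have h2 := le_of_mul_le_mul_right h1 hκ
    rw [mul_div_assoc', le_div_iff₀ hn']
    linarith
  · have h1 := middle_le_sum (κ := κ) hAB hBM hw hmid hWq
    rw [hS, le_div_iff₀ (by positivity)] at h1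
    have hR0 : 0 ≤ R := by
      rw [← hR, hL]
      exact mul_nonneg (by positivity) (sum_head_nonneg hw)
    calc (B - A : ℝ) * Wq ^ 2 * (1 - κ * Wq) * σ ^ 2
        = ((B - A : ℝ) * (Wq * (1 - κ * Wq)) * σ ^ 2) * Wq := by ring
      _ ≤ R * (n * κ) * Wq := mul_le_mul_of_nonneg_right h1 hWq.le
      _ = R * n * (κ * Wq) := by ring
      _ ≤ R * n := mul_le_of_le_one_right (by positivity) h.le
  · rw [sum_Ioc_eq_blocks (c := Wq * max (1 - κ * Wq) 0) hAB hBM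
      (fun j hj hj' => by rw [hmid j hj hj'])
      (fun j hj => by rw [htail_zero h j hj, mul_zero])] at hS
    rw [sum_Ioc_eq_blocks (c := max (1 - κ * Wq) 0) hAB hBM
      (fun j hj hj' => by rw [hmid j hj hj'])
      (fun j hj => htail_zero h j hj)] at hD
    have hP0 := sum_weights_head_le (w := w) (A := A) hκ hw
    have hP0' : 0 ≤ ∑ j ∈ Finset.Ioc 0 A, max (1 - κ * w j) 0 :=
      Finset.sum_nonneg fun j _ => le_max_right _ _
    change pinskerD s σ n lam κ = σ ^ 2 / n *
      (∑ j ∈ Finset.Ioc 0 A, max (1 - κ * w j) 0 + _) at hD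
    set P0 := ∑ j ∈ Finset.Ioc 0 A, max (1 - κ * w j) 0
    set P1 := ∑ j ∈ Finset.Ioc 0 A, w j * max (1 - κ * w j) 0
    have hmain : pinskerD s σ n lam κ - R * (κ * Wq) / Wq ^ 2 =
        σ ^ 2 * (P0 / n) - σ ^ 2 * (P1 * Wq / n) / Wq ^ 2 := by
      rw [hD, show (B - A : ℝ) * max (1 - κ * Wq) 0 = (R * (n * κ) / σ ^ 2 - P1) / Wq by
        rw [← hS]; field_simp; ring]
      field_simp
      ring
    have h0 : σ ^ 2 * (P0 / n) ≤ σ ^ 2 * (A / n) := by gcongr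
    have h1 : σ ^ 2 * (P1 * Wq / n) / Wq ^ 2 ≤ σ ^ 2 * (A * Wp * Wq / n) / Wq ^ 2 := by gcongr
    have h0' : 0 ≤ σ ^ 2 * (P0 / n) := by positivity
    have h1' : 0 ≤ σ ^ 2 * (P1 * Wq / n) / Wq ^ 2 := by positivity
    rw [hmain, abs_le]
    constructor <;> linarith

lemma weight_block_bounds {s : ℝ} (hs : 0 < s) {d p : ℕ} (hd : 1 ≤ d) {lam μ : ℕ → ℝ}
    (hpos : ∀ j, 1 ≤ j → 0 < lam j) (hanti : ∀ i j, 1 ≤ i → i ≤ j → lam j ≤ lam i)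
    (hblock : ∀ k ≤ p + 2, ∀ j : ℕ, vprev d k < (j : ℝ) → (j : ℝ) ≤ vdim d k → lam j = μ k) :
    (∀ j, 1 ≤ j → j ≤ ⌊vdim d p⌋₊ → lam j ^ (-(s / 2)) ≤ μ p ^ (-(s / 2))) ∧
    (∀ j, ⌊vdim d p⌋₊ < j → j ≤ ⌊vdim d (p + 1)⌋₊ →
      lam j ^ (-(s / 2)) = μ (p + 1) ^ (-(s / 2))) ∧
    (∀ j, ⌊vdim d (p + 1)⌋₊ < j → μ (p + 2) ^ (-(s / 2)) ≤ lam j ^ (-(s / 2))) := by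
  have hlast : ∀ k ≤ p + 2, lam ⌊vdim d k⌋₊ = μ k := fun k hk =>
    hblock k hk _ (vprev_lt_floor_vdim hd k) (floor_vdim_le hd k)
  have hfloor : ∀ k, 1 ≤ ⌊vdim d k⌋₊ := fun k => by
    have := (vprev_nonneg hd k).trans_lt (vprev_lt_floor_vdim hd k)
    exact_mod_cast this
  have hmono : ∀ i j, 1 ≤ i → i ≤ j → lam i ^ (-(s / 2)) ≤ lam j ^ (-(s / 2)) :=
    fun i j hi hij => Real.rpow_le_rpow_of_nonpos (hpos j (hi.trans hij)) (hanti i j hi hij)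
      (by linarith)
  refine ⟨fun j hj hj' => ?_, fun j hj hj' => ?_, fun j hj => ?_⟩
  · rw [← hlast p (by omega)]
    exact hmono j _ hj hj'
  · rw [hblock (p + 1) (by omega) j ?_ ?_]
    · exact Nat.lt_of_floor_lt hj
    · exact (Nat.cast_le.2 hj').trans (floor_vdim_le hd _)
  · rcases le_or_gt j ⌊vdim d (p + 2)⌋₊ with h | h
    · rw [hblock (p + 2) le_rfl j (Nat.lt_of_floor_lt hj)
        ((Nat.cast_le.2 h).trans (floor_vdim_le hd _))]
    · rw [← hlast (p + 2) le_rfl]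
      exact hmono _ j (hfloor _) h.le

/-- If `p(s+1) + s < γ < (p+1)(s+1)` then `d^{(p+1)s} · D*(d) → R a_{p+1}^s ((p+1)!)^s`. -/
theorem statement13
    (s R σ α γ : ℝ) (hs : 0 < s) (hR : 0 < R) (hσ : 0 < σ) (hα : 0 < α) (hγ : 0 < γ)
    (p : ℕ) (hp : p = ⌊γ / (s + 1)⌋₊)
    (a : ℕ → ℝ) (ha : ∀ k ≤ p + 3, 0 < a k)
    (n : ℕ → ℕ) (hn : ∀ d, 0 < n d)
    (hnlim : Tendsto (fun d : ℕ => (n d : ℝ) / (d : ℝ) ^ γ) atTop (nhds α))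
    (μ : ℕ → ℕ → ℝ)
    (hμlim : ∀ k ≤ p + 3, Tendsto (fun d : ℕ => (d : ℝ) ^ k * μ d k) atTop
      (nhds (a k * Nat.factorial k)))
    (hμorder : ∀ᶠ d in atTop, (∀ k < p + 2, μ d (k + 1) < μ d k) ∧ 0 < μ d (p + 2))
    (lam : ℕ → ℕ → ℝ)
    (hlampos : ∀ d j, 1 ≤ j → 0 < lam d j)
    (hlamanti : ∀ d i j, 1 ≤ i → i ≤ j → lam d j ≤ lam d i)
    (hlamlim : ∀ d, Tendsto (lam d) atTop (nhds 0))
    (hblock : ∀ᶠ d in atTop, ∀ k ≤ p + 2, ∀ j : ℕ,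
      vprev d k < (j : ℝ) → (j : ℝ) ≤ vdim d k → lam d j = μ d k)
    (κstar : ℕ → ℝ)
    (hκ : ∀ d, 0 < κstar d ∧ pinskerLHS s σ (n d) (lam d) (κstar d) = R)
    (h1 : (p : ℝ) * (s + 1) + s < γ) (h2 : γ < ((p : ℝ) + 1) * (s + 1)) :
    Tendsto (fun d : ℕ =>
        (d : ℝ) ^ (((p : ℝ) + 1) * s) * pinskerD s σ (n d) (lam d) (κstar d))
      atTop (nhds (R * a (p + 1) ^ s * (Nat.factorial (p + 1) : ℝ) ^ s)) := by
  have hW : ∀ k ≤ p + 2, HasPowerOrder (fun d => μ d k ^ (-(s / 2))) (-k * -(s / 2))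
      ((a k * k.factorial) ^ (-(s / 2))) := by
    intro k hk
    have hak := ha k (by omega)
    refine HasPowerOrder.rpow_const ?_ (by positivity)
    refine (hμlim k (by omega)).congr fun d => ?_
    rw [Real.rpow_neg (Nat.cast_nonneg d), Real.rpow_natCast, div_inv_eq_mul, mul_comm]
  have hc : ∀ k ≤ p + 2, 0 < (a k * k.factorial) ^ (-(s / 2)) := fun k hk => by
    have hak := ha k (by omega)
    positivity
  have hWp := hW p (by omega)
  have hWq := hW (p + 1) (by omega)
  have hWr := hW (p + 2) le_rfl
  have hcp := hc p (by omega)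
  have hcq := hc (p + 1) (by omega)
  have hcr := hc (p + 2) le_rfl
  have hWq2 := hWq.mul hWq
  have hn' : HasPowerOrder (fun d => (n d : ℝ)) γ α := hnlim
  have hone : HasPowerOrder (fun _ => (1 : ℝ)) 0 1 := by simp [HasPowerOrder]
  have hC : HasPowerOrder (fun d => sphDim d (p + 1) - 1) (p + 1 : ℕ)
      (1 / ((p + 1).factorial : ℝ)) :=
    (hasPowerOrder_sphDim (p + 1)).sub_of_lt hone (by positivity)
  have hfac : (0 : ℝ) < 1 / ((p + 1).factorial : ℝ) := by positivity
  have hT1 := (hn'.div (hC.mul hWq2) (by positivity)).tendsto_zero (by push_cast; nlinarith)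
  have hT2 := ((((hasPowerOrder_vdim p).mul hWp).mul hWq).div hn' hα.ne').tendsto_zero
    (by push_cast; nlinarith)
  have hT3 := ((HasPowerOrder.rpow_self (((p : ℝ) + 1) * s)).mul
    ((hasPowerOrder_vdim p).div hn' hα.ne')).tendsto_zero (by nlinarith)
  have hT4 := (hWr.div hWq hcq.ne').tendsto_atTop (by push_cast; nlinarith) (by positivity)
  have hT5 : Tendsto (fun d : ℕ => (d : ℝ) ^ (((p : ℝ) + 1) * s) /
      (μ d (p + 1) ^ (-(s / 2))) ^ 2) atTop
      (nhds (a (p + 1) ^ s * (Nat.factorial (p + 1) : ℝ) ^ s)) := by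
    have haq := ha (p + 1) (by omega)
    have h := (HasPowerOrder.rpow_self (((p : ℝ) + 1) * s)).div hWq2 (by positivity)
    have hexp : ((p : ℝ) + 1) * s -
        (-((p + 1 : ℕ) : ℝ) * -(s / 2) + -((p + 1 : ℕ) : ℝ) * -(s / 2)) = 0 := by
      push_cast; ring
    rw [hexp] at h
    rw [← Real.mul_rpow haq.le (by positivity)]
    have hval : 1 / ((a (p + 1) * (p + 1).factorial) ^ (-(s / 2)) *
        (a (p + 1) * (p + 1).factorial) ^ (-(s / 2))) = (a (p + 1) * (p + 1).factorial) ^ s := by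
      rw [← Real.rpow_add (by positivity), one_div, ← Real.rpow_neg (by positivity)]
      congr 1
      ring
    rw [hval] at h
    refine Tendsto.congr (fun d => ?_) h
    rw [Real.rpow_zero, div_one, sq]
  have hratio_one : ∀ᶠ d in atTop, 1 ≤ μ d (p + 2) ^ (-(s / 2)) / μ d (p + 1) ^ (-(s / 2)) :=
    hT4.eventually_ge_atTop 1
  have hratio_two : ∀ᶠ d in atTop, 2 ≤ μ d (p + 2) ^ (-(s / 2)) / μ d (p + 1) ^ (-(s / 2)) :=
    hT4.eventually_ge_atTop 2
  have hest : ∀ᶠ d : ℕ in atTop, 1 ≤ d ∧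
      (1 ≤ κstar d * μ d (p + 1) ^ (-(s / 2)) →
        R ≤ σ ^ 2 * (vdim d p * μ d p ^ (-(s / 2)) * μ d (p + 1) ^ (-(s / 2)) / n d)) ∧
      (κstar d * μ d (p + 1) ^ (-(s / 2)) < 1 →
        1 - κstar d * μ d (p + 1) ^ (-(s / 2)) ≤ R / σ ^ 2 * (n d / ((sphDim d (p + 1) - 1) *
          (μ d (p + 1) ^ (-(s / 2)) * μ d (p + 1) ^ (-(s / 2)))))) ∧
      (1 ≤ κstar d * μ d (p + 2) ^ (-(s / 2)) →
        |pinskerD s σ (n d) (lam d) (κstar d) - R * (κstar d * μ d (p + 1) ^ (-(s / 2))) /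
          (μ d (p + 1) ^ (-(s / 2))) ^ 2| ≤ σ ^ 2 * (vdim d p / n d) +
          σ ^ 2 * (vdim d p * μ d p ^ (-(s / 2)) * μ d (p + 1) ^ (-(s / 2)) / n d) /
            (μ d (p + 1) ^ (-(s / 2))) ^ 2) := by
    filter_upwards [hblock, hWp.eventually_pos hcp, hWq.eventually_pos hcq,
      hC.eventually_pos hfac, hratio_one, eventually_ge_atTop 1] with d hb hp0 hq0 hC0 hr hd
    obtain ⟨hb1, hb2, hb3⟩ := weight_block_bounds hs hd (hlampos d) (hlamanti d) hb
    have hvv := vdim_succ d p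
    have hA := floor_vdim_le hd p
    have hB := Nat.lt_floor_add_one (vdim d (p + 1))
    have hBA : sphDim d (p + 1) - 1 ≤ (⌊vdim d (p + 1)⌋₊ : ℝ) - ⌊vdim d p⌋₊ := by linarith
    have hAB : ⌊vdim d p⌋₊ ≤ ⌊vdim d (p + 1)⌋₊ := Nat.floor_mono (by linarith)
    have hnd : (0 : ℝ) < n d := by exact_mod_cast hn d
    obtain ⟨e1, e2, e3⟩ := pinsker_block_estimates hs hσ (hn d) (hκ d).1 (hlampos d) (hlamlim d)
      (hκ d).2 hAB hp0 hq0 ((one_le_div hq0).1 hr) hb1 hb2 hb3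
    refine ⟨hd, fun h => (e1 h).trans (by gcongr), fun h => ?_, fun h => (e3 h).trans (by gcongr)⟩
    rw [div_mul_div_comm, le_div_iff₀ (by positivity)]
    refine le_trans (le_of_eq_of_le ?_ (mul_le_mul_of_nonneg_right (mul_le_mul_of_nonneg_right
      (mul_le_mul_of_nonneg_right hBA (sq_nonneg (μ d (p + 1) ^ (-(s / 2))))) (sub_nonneg.2 h.le))
      (sq_nonneg σ))) (e2 h)
    ring
  have hlt : ∀ᶠ d in atTop, κstar d * μ d (p + 1) ^ (-(s / 2)) < 1 := by
    have h0 := hT2.const_mul (σ ^ 2)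
    rw [mul_zero] at h0
    filter_upwards [hest, h0.eventually_lt_const hR] with d hd hd'
    by_contra! h
    exact absurd (hd.2.1 h) hd'.not_ge
  have hκlim : Tendsto (fun d => κstar d * μ d (p + 1) ^ (-(s / 2))) atTop (nhds 1) := by
    have h0 := (hT1.const_mul (R / σ ^ 2)).const_sub 1
    rw [mul_zero, sub_zero] at h0
    refine tendsto_of_tendsto_of_tendsto_of_le_of_le' h0 tendsto_const_nhds ?_ ?_
    · filter_upwards [hest, hlt] with d hd hd'
      linarith [hd.2.2.1 hd']
    · filter_upwards [hlt] with d hd using hd.le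
  have hmain : Tendsto (fun d : ℕ => R * (κstar d * μ d (p + 1) ^ (-(s / 2))) *
      ((d : ℝ) ^ (((p : ℝ) + 1) * s) / (μ d (p + 1) ^ (-(s / 2))) ^ 2)) atTop
      (nhds (R * a (p + 1) ^ s * (Nat.factorial (p + 1) : ℝ) ^ s)) := by
    have := (hκlim.const_mul R).mul hT5
    rwa [mul_one, ← mul_assoc] at this
  have herr := (hT3.const_mul (σ ^ 2)).add ((hT2.const_mul (σ ^ 2)).mul hT5)
  rw [mul_zero, zero_mul, add_zero] at herr
  have hdiff := squeeze_zero_norm' (f := fun d : ℕ =>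
    (d : ℝ) ^ (((p : ℝ) + 1) * s) * pinskerD s σ (n d) (lam d) (κstar d) -
      R * (κstar d * μ d (p + 1) ^ (-(s / 2))) *
        ((d : ℝ) ^ (((p : ℝ) + 1) * s) / (μ d (p + 1) ^ (-(s / 2))) ^ 2)) ?_ herr
  · simpa using hdiff.add hmain
  · filter_upwards [hest, hratio_two, hWq.eventually_pos hcq,
      hκlim.eventually_const_le (show (1 / 2 : ℝ) < 1 by norm_num)] with d hd hr hq0 hκd
    have hκr : 1 ≤ κstar d * μ d (p + 2) ^ (-(s / 2)) := by
      rw [le_div_iff₀ hq0] at hr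
      nlinarith [(hκ d).1, mul_le_mul_of_nonneg_left hr (hκ d).1.le]
    have hdpos : 0 ≤ (d : ℝ) ^ (((p : ℝ) + 1) * s) := by positivity
    have h := mul_le_mul_of_nonneg_left (hd.2.2.2 hκr) hdpos
    rw [Real.norm_eq_abs]
    refine le_of_eq_of_le ?_ (h.trans_eq ?_)
    · rw [← abs_of_nonneg hdpos, ← abs_mul, abs_of_nonneg hdpos]
      congr 1
      ring
    · ring
end
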